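/- arXiv:2401.05156 — 5 statements merged into one kernel-verified Lean document; each statement's English description precedes it below -/
import Mathlib

section
/- Assume (A1), (A2), and (max_{ℝ} f)·(max_{ℝ} g) < n − 1. Let T* ∈ (0,∞) and let u be a positive classical solution on ℝ × [0,T*) such that inf_{x∈ℝ} u(x,t) > 0 for every t < T*, inf_{x∈ℝ} u(x,t) → 0 as t → T*⁻ (so T* is the quenching time), and u(x,t) = u(1−x,t) for all (x,t) ∈ ℝ × [0,T*) (this symmetry follows from uniqueness of solutions). Then lim_{t→T*⁻} u(k,t) = 0 for every k ∈ ℤ, while for every x ∈ ℝ∖ℤ the limit lim_{t→T*⁻} u(x,t) exists and is strictly positive. -/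
open Real Set Filter Topology

noncomputable section

/-- Partial derivative in the space variable `x`. -/
def pdx (u : ℝ → ℝ → ℝ) (x t : ℝ) : ℝ := deriv (fun y => u y t) x

/-- Second partial derivative in the space variable `x`. -/
def pdxx (u : ℝ → ℝ → ℝ) (x t : ℝ) : ℝ := deriv (fun y => pdx u y t) x

/-- Partial derivative in the time variable `t`. -/
def pdt (u : ℝ → ℝ → ℝ) (x t : ℝ) : ℝ := deriv (fun s => u x s) t

/-- Assumption (A1): `f` is `C¹`, `ℤ`-periodic and positive; `g` is `C²`, `ℤ`-periodic
and positive. -/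
def A1 (f g : ℝ → ℝ) : Prop :=
  ContDiff ℝ 1 f ∧ (∀ x, f (x + 1) = f x) ∧ (∀ x, 0 < f x) ∧
  ContDiff ℝ 2 g ∧ (∀ x, g (x + 1) = g x) ∧ (∀ x, 0 < g x)

/-- A positive classical solution of the scaled problem on `ℝ × [0, T)`, where
`T : EReal` with `0 < T ≤ ∞`:
`u_t = u_xx/((u_x)² + 1) − (n−1)/u + (1/ε) f(x) √((u_x)² + 1)`, `u(x,0) = ε^α g(x)`. -/
structure IsSol (n : ℕ) (f g : ℝ → ℝ) (ε α : ℝ) (T : EReal) (u : ℝ → ℝ → ℝ) : Prop where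
  pos : ∀ x t : ℝ, 0 ≤ t → (t : EReal) < T → 0 < u x t
  cont : ContinuousOn (fun p : ℝ × ℝ => u p.1 p.2)
    {p : ℝ × ℝ | 0 ≤ p.2 ∧ (p.2 : EReal) < T}
  smooth : ContDiffOn ℝ (⊤ : ℕ∞) (fun p : ℝ × ℝ => u p.1 p.2)
    {p : ℝ × ℝ | 0 < p.2 ∧ (p.2 : EReal) < T}
  periodic : ∀ x t : ℝ, u (x + 1) t = u x t
  eqn : ∀ x t : ℝ, 0 < t → (t : EReal) < T →
    pdt u x t = pdxx u x t / ((pdx u x t) ^ 2 + 1) - ((n : ℝ) - 1) / u x t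
      + (1 / ε) * f x * Real.sqrt ((pdx u x t) ^ 2 + 1)
  init : ∀ x : ℝ, u x 0 = ε ^ α * g x

/-- Assumption (A2): `f` and `g` are symmetric about `x = 1/2` on `[0,1]`, nondecreasing
on `[0,1/2]`, and `g(0) < g(1/2)`. -/
def A2 (f g : ℝ → ℝ) : Prop :=
  (∀ x ∈ Set.Icc (0 : ℝ) 1, f x = f (1 - x)) ∧
  (∀ x ∈ Set.Icc (0 : ℝ) 1, g x = g (1 - x)) ∧
  (∀ x ∈ Set.Icc (0 : ℝ) (1 / 2), 0 ≤ deriv f x) ∧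
  (∀ x ∈ Set.Icc (0 : ℝ) (1 / 2), 0 ≤ deriv g x) ∧
  g 0 < g (1 / 2)

/-- At a point where a function with two derivatives has a local minimum, the second
derivative is nonnegative. -/
lemma second_deriv_nonneg_of_isLocalMin {h h' : ℝ → ℝ} {c x : ℝ}
    (hd : ∀ᶠ y in 𝓝 x, HasDerivAt h (h' y) y) (hc : HasDerivAt h' c x)
    (hm : IsLocalMin h x) : 0 ≤ c := by
  by_contra! hneg
  have h0 : h' x = 0 := hm.hasDerivAt_eq_zero hd.self_of_nhds
  have hev : deriv h =ᶠ[𝓝 x] h' := hd.mono fun y hy => hy.deriv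
  have hc' : HasDerivAt (deriv h) c x := hc.congr_of_eventuallyEq hev
  have hmax : IsLocalMax h x :=
    isLocalMax_of_deriv_deriv_neg (by rw [hc'.deriv]; exact hneg) (by rw [hev.eq_of_nhds, h0])
      hd.self_of_nhds.continuousAt
  have hconst : h =ᶠ[𝓝 x] fun _ => h x := by
    filter_upwards [hm, hmax] with y h1 h2 using le_antisymm h2 h1
  have hz : deriv h =ᶠ[𝓝 x] fun _ => 0 := by
    refine hconst.deriv.trans (Eventually.of_forall fun y => ?_)
    simp
  have : c = 0 := hc'.unique ((hasDerivAt_const x (0 : ℝ)).congr_of_eventuallyEq hz)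
  linarith

/-- A function that is positive to the left of one of its zeros has nonpositive derivative
there. -/
lemma deriv_nonpos_of_pos_left {h : ℝ → ℝ} {c t t₀ : ℝ} (ht : t₀ < t) (hd : HasDerivAt h c t)
    (h0 : h t = 0) (hp : ∀ s ∈ Ico t₀ t, 0 ≤ h s) : c ≤ 0 := by
  have h1 := (hasDerivAt_iff_tendsto_slope.1 hd).mono_left
    (nhdsWithin_mono t (fun s (hs : s ∈ Iio t) => (ne_of_lt hs : s ≠ t)))
  refine le_of_tendsto h1 ?_
  filter_upwards [Ico_mem_nhdsLT ht] with s hs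
  rw [slope_def_field, h0]
  exact div_nonpos_of_nonneg_of_nonpos (by linarith [hp s hs]) (by linarith [hs.2])

/-- Parabolic maximum principle on a rectangle: a function which is positive initially stays
positive provided that it is strictly increasing in time wherever it could touch zero for the
first time. -/
lemma parabolic_pos {w wx wxx wt : ℝ → ℝ → ℝ} {a b t₀ t₁ : ℝ}
    (hcont : ContinuousOn (fun p : ℝ × ℝ => w p.1 p.2) (Icc a b ×ˢ Icc t₀ t₁))
    (hinit : ∀ x ∈ Icc a b, 0 < w x t₀)
    (ha : ∀ t ∈ Ioc t₀ t₁, w a t ≤ 0 → ∃ x ∈ Ioo a b, w x t ≤ 0)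
    (hb : ∀ t ∈ Ioc t₀ t₁, w b t ≤ 0 → ∃ x ∈ Ioo a b, w x t ≤ 0)
    (hx : ∀ x ∈ Ioo a b, ∀ t ∈ Ioc t₀ t₁, HasDerivAt (fun y => w y t) (wx x t) x)
    (hxx : ∀ x ∈ Ioo a b, ∀ t ∈ Ioc t₀ t₁, HasDerivAt (fun y => wx y t) (wxx x t) x)
    (ht : ∀ x ∈ Ioo a b, ∀ t ∈ Ioc t₀ t₁, HasDerivAt (fun s => w x s) (wt x t) t)
    (key : ∀ x ∈ Ioo a b, ∀ t ∈ Ioc t₀ t₁, w x t = 0 → wx x t = 0 → 0 ≤ wxx x t →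
      0 < wt x t) :
    ∀ x ∈ Icc a b, ∀ t ∈ Icc t₀ t₁, 0 < w x t := by
  by_contra! hcon
  obtain ⟨x₀, hx₀, s₀, hs₀, hw₀⟩ := hcon
  set S : Set (ℝ × ℝ) := (Icc a b ×ˢ Icc t₀ t₁) ∩ (fun p : ℝ × ℝ => w p.1 p.2) ⁻¹' Iic 0
    with hS
  have hSc : IsCompact S :=
    (isCompact_Icc.prod isCompact_Icc).of_isClosed_subset
      (hcont.preimage_isClosed_of_isClosed (isClosed_Icc.prod isClosed_Icc) isClosed_Iic)
      inter_subset_left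
  obtain ⟨⟨x₁, t⟩, hmem, hmin⟩ := hSc.exists_isMinOn (f := Prod.snd)
    ⟨(x₀, s₀), ⟨⟨hx₀, hs₀⟩, hw₀⟩⟩ continuous_snd.continuousOn
  obtain ⟨⟨hx₁, htI⟩, hw₁⟩ := hmem
  simp only [mem_preimage, mem_Iic] at hx₁ htI hw₁
  have htpos : t₀ < t := by
    rcases htI.1.eq_or_lt with h | h
    · subst h; exact absurd (hinit x₁ hx₁) (not_lt.2 hw₁)
    · exact h
  have hbefore : ∀ y ∈ Icc a b, ∀ s ∈ Ico t₀ t, 0 < w y s := by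
    intro y hy s hs
    by_contra! hle
    have : t ≤ s := hmin (a := (y, s)) ⟨⟨hy, ⟨hs.1, hs.2.le.trans htI.2⟩⟩, hle⟩
    exact absurd hs.2 (not_lt.2 this)
  have hnow : ∀ y ∈ Icc a b, 0 ≤ w y t := by
    intro y hy
    have hc : ContinuousWithinAt (fun s => w y s) (Icc t₀ t₁) t :=
      (hcont (y, t) ⟨hy, htI⟩).comp (f := fun s : ℝ => (y, s)) (s := Icc t₀ t₁)
        (by fun_prop) (fun s hs => ⟨hy, hs⟩)
    have hc' : Tendsto (fun s => w y s) (𝓝[<] t) (𝓝 (w y t)) :=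
      hc.tendsto.mono_left (by
        rw [nhdsWithin_le_iff]
        exact mem_of_superset (Ico_mem_nhdsLT htpos) fun s hs => ⟨hs.1, hs.2.le.trans htI.2⟩)
    refine ge_of_tendsto hc' ?_
    filter_upwards [Ico_mem_nhdsLT htpos] with s hs using (hbefore y hy s hs).le
  have htIoc : t ∈ Ioc t₀ t₁ := ⟨htpos, htI.2⟩
  obtain ⟨x, hxI, hwx⟩ : ∃ x ∈ Ioo a b, w x t ≤ 0 := by
    rcases hx₁.1.eq_or_lt with h | h
    · exact ha t htIoc (h ▸ hw₁)
    rcases hx₁.2.eq_or_lt with h' | h'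
    · exact hb t htIoc (h' ▸ hw₁)
    exact ⟨x₁, ⟨h, h'⟩, hw₁⟩
  have hxIcc := Ioo_subset_Icc_self hxI
  have hzero : w x t = 0 := le_antisymm hwx (hnow x hxIcc)
  have hnhds : Ioo a b ∈ 𝓝 x := isOpen_Ioo.mem_nhds hxI
  have hlm : IsLocalMin (fun y => w y t) x := by
    filter_upwards [hnhds] with y hy
    rw [hzero]
    exact hnow y (Ioo_subset_Icc_self hy)
  have h1 := hlm.hasDerivAt_eq_zero (hx x hxI t htIoc)
  have h2 := second_deriv_nonneg_of_isLocalMin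
    (by filter_upwards [hnhds] with y hy using hx y hy t htIoc) (hxx x hxI t htIoc) hlm
  have h3 := deriv_nonpos_of_pos_left htpos (ht x hxI t htIoc) hzero
    (fun s hs => (hbefore x hxIcc s hs).le)
  exact absurd (key x hxI t htIoc hzero h1 h2) (not_lt.2 h3)

/-- The open space-time slab `ℝ × (0, T)`. -/
def slab (T : ℝ) : Set (ℝ × ℝ) := {p | 0 < p.2 ∧ p.2 < T}

lemma isOpen_slab (T : ℝ) : IsOpen (slab T) :=
  (isOpen_lt continuous_const continuous_snd).inter (isOpen_lt continuous_snd continuous_const)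

/-- Smoothness on the slab, for curried functions. -/
def SmoothOn (T : ℝ) (w : ℝ → ℝ → ℝ) : Prop :=
  ContDiffOn ℝ (⊤ : ℕ∞) (fun p : ℝ × ℝ => w p.1 p.2) (slab T)

namespace SmoothOn

variable {T : ℝ} {w : ℝ → ℝ → ℝ}

lemma hasFDerivAt (hw : SmoothOn T w) {p : ℝ × ℝ} (hp : p ∈ slab T) :
    HasFDerivAt (fun p : ℝ × ℝ => w p.1 p.2) (fderiv ℝ (fun p : ℝ × ℝ => w p.1 p.2) p) p :=
  ((hw.contDiffAt ((isOpen_slab T).mem_nhds hp)).differentiableAt (by simp)).hasFDerivAt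

lemma hasDerivAt_fderiv_fst (hw : SmoothOn T w) {x t : ℝ} (h0 : 0 < t) (h1 : t < T) :
    HasDerivAt (fun y => w y t) (fderiv ℝ (fun p : ℝ × ℝ => w p.1 p.2) (x, t) (1, 0)) x :=
  (hw.hasFDerivAt (p := (x, t)) ⟨h0, h1⟩).comp_hasDerivAt (f := fun y : ℝ => (y, t)) x
    ((hasDerivAt_id x).prodMk (hasDerivAt_const x t))

lemma hasDerivAt_fderiv_snd (hw : SmoothOn T w) {x t : ℝ} (h0 : 0 < t) (h1 : t < T) :
    HasDerivAt (fun s => w x s) (fderiv ℝ (fun p : ℝ × ℝ => w p.1 p.2) (x, t) (0, 1)) t :=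
  (hw.hasFDerivAt (p := (x, t)) ⟨h0, h1⟩).comp_hasDerivAt (f := fun s : ℝ => (x, s)) t
    ((hasDerivAt_const t x).prodMk (hasDerivAt_id t))

lemma pdx_eq (hw : SmoothOn T w) {x t : ℝ} (h0 : 0 < t) (h1 : t < T) :
    pdx w x t = fderiv ℝ (fun p : ℝ × ℝ => w p.1 p.2) (x, t) (1, 0) :=
  (hw.hasDerivAt_fderiv_fst h0 h1).deriv

lemma pdt_eq (hw : SmoothOn T w) {x t : ℝ} (h0 : 0 < t) (h1 : t < T) :
    pdt w x t = fderiv ℝ (fun p : ℝ × ℝ => w p.1 p.2) (x, t) (0, 1) :=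
  (hw.hasDerivAt_fderiv_snd h0 h1).deriv

lemma hasDerivAt_pdx (hw : SmoothOn T w) {x t : ℝ} (h0 : 0 < t) (h1 : t < T) :
    HasDerivAt (fun y => w y t) (pdx w x t) x := by
  rw [hw.pdx_eq h0 h1]; exact hw.hasDerivAt_fderiv_fst h0 h1

lemma hasDerivAt_pdt (hw : SmoothOn T w) {x t : ℝ} (h0 : 0 < t) (h1 : t < T) :
    HasDerivAt (fun s => w x s) (pdt w x t) t := by
  rw [hw.pdt_eq h0 h1]; exact hw.hasDerivAt_fderiv_snd h0 h1

lemma pdx (hw : SmoothOn T w) : SmoothOn T (pdx w) := by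
  have h := (ContDiffOn.fderiv_of_isOpen hw (isOpen_slab T)
    (m := ((⊤ : ℕ∞) : WithTop ℕ∞)) (by simp)).clm_apply
    (contDiffOn_const (c := ((1 : ℝ), (0 : ℝ))))
  exact h.congr fun p hp => hw.pdx_eq hp.1 hp.2

lemma pdt (hw : SmoothOn T w) : SmoothOn T (pdt w) := by
  have h := (ContDiffOn.fderiv_of_isOpen hw (isOpen_slab T)
    (m := ((⊤ : ℕ∞) : WithTop ℕ∞)) (by simp)).clm_apply
    (contDiffOn_const (c := ((0 : ℝ), (1 : ℝ))))
  exact h.congr fun p hp => hw.pdt_eq hp.1 hp.2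

lemma pdt_pdx (hw : SmoothOn T w) {x t : ℝ} (h0 : 0 < t) (h1 : t < T) :
    _root_.pdt (_root_.pdx w) x t = _root_.pdx (_root_.pdt w) x t := by
  have hp : (x, t) ∈ slab T := ⟨h0, h1⟩
  have hnh := (isOpen_slab T).mem_nhds hp
  set F : ℝ × ℝ → ℝ := fun p => w p.1 p.2 with hF
  have hFd : HasFDerivAt (fderiv ℝ F) (fderiv ℝ (fderiv ℝ F) (x, t)) (x, t) :=
    (((ContDiffOn.fderiv_of_isOpen hw (isOpen_slab T)
      (m := ((⊤ : ℕ∞) : WithTop ℕ∞)) (by simp)).contDiffAt hnh).differentiableAt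
        (by simp)).hasFDerivAt
  have hsymm : IsSymmSndFDerivAt ℝ F (x, t) :=
    (hw.contDiffAt hnh).isSymmSndFDerivAt (by
      simpa using WithTop.coe_le_coe.2 (le_top : (2 : ℕ∞) ≤ ⊤))
  have e1 : _root_.pdt (_root_.pdx w) x t = fderiv ℝ (fderiv ℝ F) (x, t) (0, 1) (1, 0) := by
    rw [hw.pdx.pdt_eq h0 h1]
    have : (fun p : ℝ × ℝ => _root_.pdx w p.1 p.2) =ᶠ[𝓝 (x, t)] fun p => fderiv ℝ F p (1, 0) := by
      filter_upwards [hnh] with p hp using hw.pdx_eq hp.1 hp.2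
    rw [this.fderiv_eq, (hFd.clm_apply (hasFDerivAt_const ((1 : ℝ), (0 : ℝ)) (x, t))).fderiv]
    simp
  have e2 : _root_.pdx (_root_.pdt w) x t = fderiv ℝ (fderiv ℝ F) (x, t) (1, 0) (0, 1) := by
    rw [hw.pdt.pdx_eq h0 h1]
    have : (fun p : ℝ × ℝ => _root_.pdt w p.1 p.2) =ᶠ[𝓝 (x, t)] fun p => fderiv ℝ F p (0, 1) := by
      filter_upwards [hnh] with p hp using hw.pdt_eq hp.1 hp.2
    rw [this.fderiv_eq, (hFd.clm_apply (hasFDerivAt_const ((0 : ℝ), (1 : ℝ)) (x, t))).fderiv]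
    simp
  rw [e1, e2]
  exact hsymm _ _

end SmoothOn

/-- Positive solutions of `u_t = u_xx/((u_x)² + 1) − N/u + f(x) √((u_x)² + 1)` on
`ℝ × [0, T)`, periodic in space. -/
structure IsFlow (T N : ℝ) (f : ℝ → ℝ) (u : ℝ → ℝ → ℝ) : Prop where
  nonneg : 0 ≤ N
  smooth : SmoothOn T u
  pos : ∀ x t, 0 ≤ t → t < T → 0 < u x t
  cont : ContinuousOn (fun p : ℝ × ℝ => u p.1 p.2) {p | 0 ≤ p.2 ∧ p.2 < T}
  periodic : ∀ x t, u (x + 1) t = u x t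
  eqn : ∀ x t, 0 < t → t < T → pdt u x t = pdxx u x t / ((pdx u x t) ^ 2 + 1) - N / u x t
    + f x * √((pdx u x t) ^ 2 + 1)
  diff : ContDiff ℝ 1 f
  force_periodic : ∀ x, f (x + 1) = f x
  force_pos : ∀ x, 0 < f x

lemma exists_bound_of_periodic {h : ℝ → ℝ} (hc : Continuous h) (hp : ∀ x, h (x + 1) = h x) :
    ∃ C, 0 < C ∧ ∀ x, h x ≤ C := by
  obtain ⟨C, hC⟩ := (isCompact_Icc (a := (0 : ℝ)) (b := 1)).bddAbove_image hc.continuousOn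
  refine ⟨max C 1, by positivity, fun x => ?_⟩
  have hper : Function.Periodic h 1 := hp
  obtain ⟨y, hy, hxy⟩ := hper.exists_mem_Ico₀ one_pos x
  rw [hxy]
  exact (hC ⟨y, ⟨hy.1, hy.2.le⟩, rfl⟩).trans (le_max_left _ _)

/-- A periodic force which is symmetric about `1/2` and nondecreasing on `[0, 1/2]` does not
decrease under reflection away from the minimum. -/
lemma le_reflect {h : ℝ → ℝ} (hp : ∀ x, h (x + 1) = h x)
    (hs : ∀ x ∈ Icc (0 : ℝ) 1, h x = h (1 - x)) (hm : MonotoneOn h (Icc 0 (1 / 2)))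
    {l x : ℝ} (hl0 : 0 < l) (hl : l < 1 / 2) (hx : x ∈ Icc (l - 1 / 2) l) :
    h x ≤ h (2 * l - x) := by
  have aux : ∀ z y : ℝ, 0 ≤ z → z ≤ 1 / 2 → z ≤ y → y ≤ 1 - z → h z ≤ h y := by
    intro z y h0 h1 h2 h3
    rcases le_total y (1 / 2) with h4 | h4
    · exact hm ⟨h0, h1⟩ ⟨h0.trans h2, h4⟩ h2
    · rw [hs y ⟨by linarith, by linarith⟩]
      exact hm ⟨h0, h1⟩ ⟨by linarith, by linarith⟩ (by linarith)
  obtain ⟨hx1, hx2⟩ := hx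
  rcases le_total 0 x with h0 | h0
  · exact aux _ _ h0 (by linarith) (by linarith) (by linarith)
  · have : h x = h (-x) := by
      rw [hs (-x) ⟨by linarith, by linarith⟩, ← hp x]
      congr 1; ring
    rw [this]
    exact aux _ _ (by linarith) (by linarith) (by linarith) (by linarith)

namespace IsFlow

variable {T N : ℝ} {f : ℝ → ℝ} {u : ℝ → ℝ → ℝ}

lemma hasDerivAt_x (hu : IsFlow T N f u) {x t : ℝ} (h0 : 0 < t) (h1 : t < T) :
    HasDerivAt (fun y => u y t) (pdx u x t) x := hu.smooth.hasDerivAt_pdx h0 h1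

lemma hasDerivAt_xx (hu : IsFlow T N f u) {x t : ℝ} (h0 : 0 < t) (h1 : t < T) :
    HasDerivAt (fun y => pdx u y t) (pdxx u x t) x := hu.smooth.pdx.hasDerivAt_pdx h0 h1

lemma hasDerivAt_t (hu : IsFlow T N f u) {x t : ℝ} (h0 : 0 < t) (h1 : t < T) :
    HasDerivAt (fun s => u x s) (pdt u x t) t := hu.smooth.hasDerivAt_pdt h0 h1

lemma continuousOn_rect (hu : IsFlow T N f u) {a b t₀ t₁ : ℝ} (h0 : 0 ≤ t₀) (h1 : t₁ < T) :
    ContinuousOn (fun p : ℝ × ℝ => u p.1 p.2) (Icc a b ×ˢ Icc t₀ t₁) :=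
  hu.cont.mono fun _ hp => ⟨h0.trans hp.2.1, hp.2.2.trans_lt h1⟩

lemma continuousOn_pdx (hu : IsFlow T N f u) {a b t₀ t₁ : ℝ} (h0 : 0 < t₀) (h1 : t₁ < T) :
    ContinuousOn (fun p : ℝ × ℝ => pdx u p.1 p.2) (Icc a b ×ˢ Icc t₀ t₁) :=
  hu.smooth.pdx.continuousOn.mono fun _ hp => ⟨h0.trans_le hp.2.1, hp.2.2.trans_lt h1⟩

/-- The equation satisfied by the slope. -/
lemma pdt_pdx (hu : IsFlow T N f u) {x t : ℝ} (h0 : 0 < t) (h1 : t < T) :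
    pdt (pdx u) x t =
      (pdxx (pdx u) x t / ((pdx u x t) ^ 2 + 1)
        - 2 * pdx u x t * (pdxx u x t) ^ 2 / ((pdx u x t) ^ 2 + 1) ^ 2)
      + N * pdx u x t / (u x t) ^ 2 + deriv f x * √((pdx u x t) ^ 2 + 1)
      + f x * (pdx u x t * pdxx u x t / √((pdx u x t) ^ 2 + 1)) := by
  rw [hu.smooth.pdt_pdx h0 h1]
  have hx := hu.hasDerivAt_x (x := x) h0 h1
  have hxx := hu.hasDerivAt_xx (x := x) h0 h1
  have hxxx : HasDerivAt (fun y => pdxx u y t) (pdxx (pdx u) x t) x :=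
    hu.smooth.pdx.pdx.hasDerivAt_pdx h0 h1
  have hf : HasDerivAt f (deriv f x) x := (hu.diff.differentiable (by simp) x).hasDerivAt
  have hpos : 0 < (pdx u x t) ^ 2 + 1 := by positivity
  have hsq : HasDerivAt (fun y => (pdx u y t) ^ 2 + 1) (2 * pdx u x t * pdxx u x t) x := by
    simpa using (hxx.pow 2).add_const 1
  have hne := (hu.pos x t h0.le h1).ne'
  have h := ((hxxx.div hsq hpos.ne').sub ((hasDerivAt_const x N).div hx hne)).add
    (hf.mul (hsq.sqrt hpos.ne'))
  have e : (fun y => pdt u y t) = fun y => pdxx u y t / ((pdx u y t) ^ 2 + 1) - N / u y t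
      + f y * √((pdx u y t) ^ 2 + 1) := funext fun y => hu.eqn y t h0 h1
  rw [show pdx (pdt u) x t = deriv (fun y => pdt u y t) x from rfl, e]
  refine h.deriv.trans ?_
  have hs : 0 < √((pdx u x t) ^ 2 + 1) := Real.sqrt_pos.2 hpos
  have hne1 := hpos.ne'
  have hne2 := hs.ne'
  field_simp
  ring

/-- Solutions are bounded above on finite time intervals. -/
lemma exists_upper_bound (hu : IsFlow T N f u) (hT : 0 < T) :
    ∃ M, 0 < M ∧ ∀ x t, 0 ≤ t → t < T → u x t ≤ M := by
  obtain ⟨F, hF, hfF⟩ := exists_bound_of_periodic hu.diff.continuous hu.force_periodic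
  obtain ⟨G, hG, hgG⟩ := exists_bound_of_periodic (h := fun x => u x 0)
    (continuousOn_univ.1 (hu.cont.comp (f := fun x : ℝ => (x, (0 : ℝ))) (by fun_prop)
      (fun x _ => ⟨le_rfl, hT⟩))) (fun x => hu.periodic x 0)
  refine ⟨G + 1 + (F + 1) * T, by positivity, fun x t h0 h1 => ?_⟩
  obtain ⟨y, hy, hxy⟩ := (show Function.Periodic (fun x => u x t) 1 from
    fun x => hu.periodic x t).exists_mem_Ico₀ one_pos x
  have hmain := parabolic_pos (a := 0) (b := 2) (t₀ := 0) (t₁ := t)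
    (w := fun x t => G + 1 + (F + 1) * t - u x t) (wx := fun x t => - pdx u x t)
    (wxx := fun x t => - pdxx u x t) (wt := fun x t => (F + 1) - pdt u x t)
    (ContinuousOn.sub (by fun_prop) (hu.continuousOn_rect le_rfl h1))
    (fun x _ => by have := hgG x; linarith)
    (fun s _ h => ⟨1, by norm_num, by
      have := hu.periodic 0 s; norm_num at this; rw [this]; exact h⟩)
    (fun s _ h => ⟨1, by norm_num, by
      have := hu.periodic 1 s; norm_num at this; rw [← this]; exact h⟩)
    (fun x _ s hs => by
      simpa using (hu.hasDerivAt_x (x := x) hs.1 (hs.2.trans_lt h1)).const_sub _)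
    (fun x _ s hs => (hu.hasDerivAt_xx hs.1 (hs.2.trans_lt h1)).neg)
    (fun x _ s hs => by
      simpa using (((hasDerivAt_id s).const_mul (F + 1)).const_add (G + 1)).fun_sub
        (hu.hasDerivAt_t (x := x) hs.1 (hs.2.trans_lt h1)))
    (fun x _ s hs _ hx hxx => by
      have e := hu.eqn x s hs.1 (hs.2.trans_lt h1)
      have hx0 : pdx u x s = 0 := by linarith
      rw [hx0] at e
      norm_num at e
      have h2 : 0 ≤ N / u x s := div_nonneg hu.nonneg (hu.pos x s hs.1.le (hs.2.trans_lt h1)).le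
      have h3 := hfF x
      show 0 < F + 1 - pdt u x s
      rw [e]
      linarith)
    y ⟨hy.1, by linarith [hy.2]⟩ t ⟨h0, le_rfl⟩
  rw [hxy]
  nlinarith

lemma exists_pos_lower_bound (hu : IsFlow T N f u) {t₁ : ℝ} (h0 : 0 ≤ t₁) (h1 : t₁ < T) :
    ∃ m, 0 < m ∧ ∀ x, ∀ t ∈ Icc 0 t₁, m ≤ u x t := by
  obtain ⟨⟨x₀, s₀⟩, hm, hmin⟩ := ((isCompact_Icc (a := (0 : ℝ)) (b := 1)).prod
    (isCompact_Icc (a := 0) (b := t₁))).exists_isMinOn ⟨(0, 0), by simp [h0]⟩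
    (hu.continuousOn_rect le_rfl h1)
  refine ⟨u x₀ s₀, hu.pos _ _ hm.2.1 (hm.2.2.trans_lt h1), fun x t ht => ?_⟩
  obtain ⟨y, hy, hxy⟩ := (show Function.Periodic (fun x => u x t) 1 from
    fun x => hu.periodic x t).exists_mem_Ico₀ one_pos x
  rw [hxy]
  exact hmin (a := (y, t)) ⟨⟨hy.1, hy.2.le⟩, ht⟩

/-- The solution stays nondecreasing on `[0, 1/2]`. -/
lemma monotoneOn (hu : IsFlow T N f u) (hf : ∀ l x, 0 < l → l < 1 / 2 →
      x ∈ Icc (l - 1 / 2) l → f x ≤ f (2 * l - x))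
    (hg : ∀ l x, 0 < l → l < 1 / 2 → x ∈ Icc (l - 1 / 2) l → u x 0 ≤ u (2 * l - x) 0)
    {t₁ : ℝ} (h0 : 0 ≤ t₁) (h1 : t₁ < T) : MonotoneOn (fun x => u x t₁) (Icc 0 (1 / 2)) := by
  obtain ⟨m, hm, hum⟩ := hu.exists_pos_lower_bound h0 h1
  intro x hx y hy hxy
  dsimp only
  rcases hxy.eq_or_lt with h | h
  · rw [h]
  obtain ⟨l, rfl⟩ : ∃ l, y = 2 * l - x := ⟨(x + y) / 2, by ring⟩
  have hl0 : 0 < l := by linarith [hx.1, hy.1]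
  have hl : l < 1 / 2 := by linarith [hx.2, hy.2]
  set K : ℝ := N / m ^ 2 + 1 with hK
  suffices hs : ∀ η > 0, u x t₁ ≤ u (2 * l - x) t₁ + η by
    exact le_of_forall_pos_le_add hs
  intro η hη
  set e : ℝ → ℝ := fun t => η * exp (K * (t - t₁)) with he
  have hepos : ∀ t, 0 < e t := fun t => by positivity
  have hed : ∀ t, HasDerivAt e (K * e t) t := fun t => by
    have := ((((hasDerivAt_id t).sub_const t₁).const_mul K).exp).const_mul η
    refine this.congr_deriv ?_
    simp only [he, id]; ring
  have hpx : ∀ x, ∀ s ∈ Ioc 0 t₁, HasDerivAt (fun y => u (2 * l - y) s)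
      (-pdx u (2 * l - x) s) x := fun x s hs => by
    simpa using (hu.hasDerivAt_x (x := 2 * l - x) hs.1 (hs.2.trans_lt h1)).comp_const_sub (2 * l) x
  have hmain := parabolic_pos (a := l - 1 / 2) (b := l) (t₀ := 0) (t₁ := t₁)
    (w := fun x t => u (2 * l - x) t - u x t + e t)
    (wx := fun x t => - pdx u (2 * l - x) t - pdx u x t)
    (wxx := fun x t => pdxx u (2 * l - x) t - pdxx u x t)
    (wt := fun x t => pdt u (2 * l - x) t - pdt u x t + K * e t)
    (by
      refine ContinuousOn.add (ContinuousOn.sub ?_ (hu.continuousOn_rect le_rfl h1)) (by fun_prop)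
      exact (hu.continuousOn_rect (a := l) (b := l + 1 / 2) le_rfl h1).comp
        (f := fun p : ℝ × ℝ => (2 * l - p.1, p.2)) (by fun_prop)
        (fun p hp => ⟨⟨by linarith [hp.1.2], by linarith [hp.1.1]⟩, hp.2⟩))
    (fun x hx => by have := hg l x hl0 hl hx; have := hepos 0; linarith)
    (fun s _ h => absurd h (not_le.2 (by
      have e1 := hu.periodic (l - 1 / 2) s
      rw [show l - 1 / 2 + 1 = 2 * l - (l - 1 / 2) by ring] at e1
      rw [e1]; linarith [hepos s])))
    (fun s _ h => absurd h (not_le.2 (by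
      rw [show 2 * l - l = l by ring]; linarith [hepos s])))
    (fun x _ s hs => ((hpx x s hs).fun_sub (hu.hasDerivAt_x hs.1 (hs.2.trans_lt h1))).add_const _)
    (fun x _ s hs => by
      have := (hu.hasDerivAt_xx (x := 2 * l - x) hs.1 (hs.2.trans_lt h1)).comp_const_sub (2 * l) x
      simpa using this.fun_neg.fun_sub (hu.hasDerivAt_xx (x := x) hs.1 (hs.2.trans_lt h1)))
    (fun x _ s hs => ((hu.hasDerivAt_t hs.1 (hs.2.trans_lt h1)).sub
        (hu.hasDerivAt_t hs.1 (hs.2.trans_lt h1))).add (hed s))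
    (fun x hx s hs hw hwx hwxx => by
      have hs1 := hs.2.trans_lt h1
      have e1 := hu.eqn x s hs.1 hs1
      have e2 := hu.eqn (2 * l - x) s hs.1 hs1
      have hpx : pdx u (2 * l - x) s = - pdx u x s := by linarith
      rw [hpx, neg_sq] at e2
      have hff := hf l x hl0 hl (Ioo_subset_Icc_self hx)
      have hm1 := hum x s ⟨hs.1.le, hs.2⟩
      have hm2 := hum (2 * l - x) s ⟨hs.1.le, hs.2⟩
      have hab : u x s = u (2 * l - x) s + e s := by linarith
      have hq : pdxx u x s / (pdx u x s ^ 2 + 1) ≤ pdxx u (2 * l - x) s / (pdx u x s ^ 2 + 1) := by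
        gcongr; linarith
      have hr : f x * √(pdx u x s ^ 2 + 1) ≤ f (2 * l - x) * √(pdx u x s ^ 2 + 1) := by
        gcongr
      have hN : N / u (2 * l - x) s - N / u x s ≤ N / m ^ 2 * e s := by
        have p1 : 0 < u (2 * l - x) s := by linarith
        have p2 : 0 < u x s := by linarith
        have : N / u (2 * l - x) s - N / u x s = N / (u (2 * l - x) s * u x s) * e s := by
          rw [div_sub_div _ _ p1.ne' p2.ne', hab]; ring
        rw [this]
        have := hepos s
        have := hu.nonneg
        gcongr
        nlinarith
      have h3 := hepos s
      have h4 : K * e s = N / m ^ 2 * e s + e s := by rw [hK]; ring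
      rw [e1, e2, h4]
      linarith)
    x ⟨by linarith [hx.1], by linarith⟩ t₁ ⟨h0, le_rfl⟩
  have : e t₁ = η := by simp [he]
  linarith

end IsFlow

lemma hasDerivAt_bump (E α β x : ℝ) :
    HasDerivAt (fun y => E * ((y - α) * (β - y)) ^ 3)
      (3 * E * ((x - α) * (β - x)) ^ 2 * (α + β - 2 * x)) x := by
  have h := ((((hasDerivAt_id x).sub_const α).mul ((hasDerivAt_id x).const_sub β)).pow 3).const_mul E
  refine h.congr_deriv ?_
  simp [id]; ring

lemma hasDerivAt_bump_x (E α β x : ℝ) :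
    HasDerivAt (fun y => 3 * E * ((y - α) * (β - y)) ^ 2 * (α + β - 2 * y))
      (E * (6 * ((x - α) * (β - x)) * (α + β - 2 * x) ^ 2 - 6 * ((x - α) * (β - x)) ^ 2)) x := by
  have h := (((((hasDerivAt_id x).sub_const α).mul ((hasDerivAt_id x).const_sub β)).pow 2).const_mul
    (3 * E)).mul (((hasDerivAt_id x).const_mul 2).const_sub (α + β))
  refine h.congr_deriv ?_
  simp [id]; ring

lemma hasDerivAt_bump_t (ε K t₀ x : ℝ) {α β : ℝ → ℝ} {α' β' t : ℝ} (hα : HasDerivAt α α' t)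
    (hβ : HasDerivAt β β' t) :
    HasDerivAt (fun s => ε * exp (-K * (s - t₀)) * ((x - α s) * (β s - x)) ^ 3)
      (ε * exp (-K * (t - t₀)) * (-K * ((x - α t) * (β t - x)) ^ 3
        + 3 * ((x - α t) * (β t - x)) ^ 2 * (-α' * (β t - x) + β' * (x - α t)))) t := by
  have h := (((((hasDerivAt_id t).sub_const t₀).const_mul (-K)).exp).const_mul ε).mul
    (((hα.const_sub x).mul (hβ.sub_const x)).pow 3)
  refine h.congr_deriv ?_
  simp [id]; ring

/-- The inequality making the cubic bump a strict subsolution of the slope equation. -/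
lemma bump_subsolution {E q v vx vxx r D D₀ s F φ K qt : ℝ} (hE0 : 0 < E) (hE1 : E ≤ 1)
    (hq0 : 0 < q) (hq1 : q ≤ 1) (hv0 : 0 ≤ v) (hv : v ≤ E * q ^ 3) (hr : r ^ 2 = D ^ 2 - 4 * q)
    (hr1 : |r| ≤ 1) (hvx : vx = 3 * E * q ^ 2 * r)
    (hvxx : E * (6 * q * r ^ 2 - 6 * q ^ 2) ≤ vxx) (hqt : qt ≤ s) (hφ0 : 0 ≤ φ) (hφ : φ ≤ F)
    (hD₀ : 0 ≤ D₀) (hD : D₀ ≤ D) (hK : (48 + 3 * F + 3 * s) ^ 2 < 12 * D₀ ^ 2 * K) :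
    E * (-K * q ^ 3 + 3 * q ^ 2 * qt) <
      (vxx / (v ^ 2 + 1) - 2 * v * vx ^ 2 / (v ^ 2 + 1) ^ 2) + φ * (v * vx / √(v ^ 2 + 1)) := by
  have hq3 : q ^ 3 ≤ 1 := pow_le_one₀ hq0.le hq1
  have hEq : E * q ^ 3 ≤ 1 := mul_le_one₀ hE1 (by positivity) hq3
  have hv1 : v ≤ 1 := hv.trans hEq
  have hP1 : 1 ≤ v ^ 2 + 1 := by nlinarith
  have hP2 : v ^ 2 + 1 ≤ 2 := by nlinarith
  have hP0 : 0 < v ^ 2 + 1 := by linarith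
  have hr2 : r ^ 2 ≤ 1 := by rw [← sq_abs]; exact pow_le_one₀ (abs_nonneg r) hr1
  have hvq : v * q ^ 2 ≤ E * q ^ 2 * q := by
    have := mul_le_mul_of_nonneg_right hv (sq_nonneg q)
    have h5 : E * q ^ 3 * q ^ 2 ≤ E * q ^ 2 * q * 1 := by
      rw [show E * q ^ 3 * q ^ 2 = E * q ^ 2 * q * q ^ 2 by ring]
      gcongr
      exact pow_le_one₀ hq0.le hq1
    linarith
  have h1 : E * (3 * q * D ^ 2 - 30 * q ^ 2) ≤ vxx / (v ^ 2 + 1) := by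
    rw [le_div_iff₀ hP0]
    refine le_trans ?_ hvxx
    rw [hr]
    have a1 : E * q * D ^ 2 * (v ^ 2 + 1) ≤ E * q * D ^ 2 * 2 := by gcongr
    have a2 : E * q ^ 2 * 1 ≤ E * q ^ 2 * (v ^ 2 + 1) := by gcongr
    nlinarith
  have h2 : 2 * v * vx ^ 2 / (v ^ 2 + 1) ^ 2 ≤ 18 * E * q ^ 2 := by
    have a1 : 2 * v * vx ^ 2 / (v ^ 2 + 1) ^ 2 ≤ 2 * v * vx ^ 2 :=
      div_le_self (by positivity) (one_le_pow₀ hP1)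
    have a2 : 2 * v * vx ^ 2 ≤ 2 * 1 * (9 * (E * (E * (q ^ 2 * (q ^ 2 * 1))))) := by
      rw [hvx, show (3 * E * q ^ 2 * r) ^ 2 = 9 * (E * (E * (q ^ 2 * (q ^ 2 * r ^ 2)))) by ring]
      gcongr
    have a3 : E * (E * (q ^ 2 * (q ^ 2 * 1))) ≤ E * (1 * (q ^ 2 * (1 * 1))) := by
      gcongr
      exact pow_le_one₀ hq0.le hq1
    linarith
  have h3 : -(3 * F * E * q ^ 2) ≤ φ * (v * vx / √(v ^ 2 + 1)) := by
    have hs : 1 ≤ √(v ^ 2 + 1) := Real.one_le_sqrt.2 hP1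
    have a1 : |v * vx / √(v ^ 2 + 1)| ≤ 3 * E * q ^ 2 := by
      rw [abs_div, abs_of_pos (by linarith : 0 < √(v ^ 2 + 1))]
      refine (div_le_self (abs_nonneg _) hs).trans ?_
      rw [abs_mul, abs_of_nonneg hv0, hvx, abs_mul,
        abs_of_pos (by positivity : 0 < 3 * E * q ^ 2)]
      calc v * (3 * E * q ^ 2 * |r|) ≤ 1 * (3 * E * q ^ 2 * 1) := by gcongr
        _ = _ := by ring
    have a2 : φ * |v * vx / √(v ^ 2 + 1)| ≤ F * (3 * E * q ^ 2) := by gcongr; linarith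
    have a3 := mul_le_mul_of_nonneg_left (neg_abs_le (v * vx / √(v ^ 2 + 1))) hφ0
    linarith
  have h4 : 0 < E * q * (3 * D ^ 2 - (48 + 3 * F + 3 * s) * q + K * q ^ 2) := by
    refine mul_pos (mul_pos hE0 hq0) ?_
    set A := 48 + 3 * F + 3 * s with hA
    have hDD : D₀ ^ 2 ≤ D ^ 2 := by gcongr
    have hK0 : 0 < K := by
      by_contra! hneg
      nlinarith [sq_nonneg A, mul_nonneg (sq_nonneg D₀) (neg_nonneg.2 hneg)]
    have hb : 0 < 4 * K * (3 * D₀ ^ 2 - A * q + K * q ^ 2) := by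
      nlinarith [sq_nonneg (2 * K * q - A)]
    have hb' := pos_of_mul_pos_right hb (by positivity)
    linarith
  have h5 : E * (3 * q ^ 2 * qt) ≤ E * (3 * q ^ 2 * s) := by gcongr
  nlinarith

/-- The inequality making the complement of the cubic bump a strict supersolution of the
equation for the tangent angle. -/
lemma bump_supersolution {E q v vx A B r D F φ φ' K C₁ C₂ : ℝ} (hE0 : 0 < E) (hE1 : E ≤ 1)
    (hq0 : 0 < q) (hq1 : q ≤ 1) (hv0 : 0 ≤ v) (hσ : 1 / √(v ^ 2 + 1) ≤ E * q ^ 3)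
    (hA : A ≤ E * (6 * q ^ 2 - 6 * q * r ^ 2)) (hvx : vx = -(3 * E * q ^ 2 * r) * (v ^ 2 + 1))
    (hr : |r| ≤ D) (hφ0 : 0 ≤ φ) (hφ : φ ≤ F) (hφ' : φ' ≤ C₂) (hC₂ : 0 ≤ C₂) (hC₁ : 0 ≤ C₁)
    (hB : B ≤ C₁ * v) (hK : 6 + C₁ + C₂ < K) :
    (A + B + φ' * √(v ^ 2 + 1) + φ * (v * vx / √(v ^ 2 + 1))) / (v ^ 2 + 1) <
      E * (K * q ^ 3 + 3 * q ^ 2 * (F * D)) := by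
  have hP0 : 0 < v ^ 2 + 1 := by positivity
  have hRR : √(v ^ 2 + 1) ^ 2 = v ^ 2 + 1 := Real.sq_sqrt hP0.le
  have hR0 : 0 < √(v ^ 2 + 1) := Real.sqrt_pos.2 hP0
  have hvR : v ≤ √(v ^ 2 + 1) := Real.le_sqrt_of_sq_le (by linarith)
  have hR1 : 1 ≤ √(v ^ 2 + 1) := Real.one_le_sqrt.2 (by nlinarith)
  set R := √(v ^ 2 + 1)
  rw [hvx, ← hRR]
  set σ := 1 / R with hσd
  have hσ0 : 0 < σ := by positivity
  have hσR : σ * R = 1 := by rw [hσd]; field_simp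
  have hσ1 : σ ≤ 1 := by rw [hσd, div_le_one hR0]; exact hR1
  have hvσ : v * σ ≤ 1 := by nlinarith
  have hq3 : q ^ 3 ≤ 1 := pow_le_one₀ hq0.le hq1
  have hψ1 : E * q ^ 3 ≤ 1 := mul_le_one₀ hE1 (by positivity) hq3
  have hψ0 : 0 < E * q ^ 3 := by positivity
  have e : (A + B + φ' * R + φ * (v * (-(3 * E * q ^ 2 * r) * R ^ 2) / R)) / R ^ 2
      = σ ^ 2 * A + σ ^ 2 * B + φ' * σ + φ * ((v * σ) * (-(3 * E * q ^ 2 * r))) := by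
    rw [hσd]; field_simp
  rw [e]
  have hσσ : σ ^ 2 ≤ E * q ^ 3 := by nlinarith
  have h1 : σ ^ 2 * A ≤ 6 * (E * q ^ 3) := by
    have a1 : A ≤ 6 * (E * q ^ 2) := by nlinarith [mul_nonneg (mul_nonneg hE0.le hq0.le) (sq_nonneg r)]
    have a2 : E * q ^ 2 ≤ 1 := mul_le_one₀ hE1 (by positivity) (pow_le_one₀ hq0.le hq1)
    have a3 : σ ^ 2 * A ≤ σ ^ 2 * 6 := by gcongr; linarith
    linarith
  have h2 : σ ^ 2 * B ≤ C₁ * (E * q ^ 3) := by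
    calc σ ^ 2 * B ≤ σ ^ 2 * (C₁ * v) := by gcongr
      _ = C₁ * (σ * (v * σ)) := by ring
      _ ≤ C₁ * (E * q ^ 3 * 1) := by gcongr
      _ = _ := by ring
  have h3 : φ' * σ ≤ C₂ * (E * q ^ 3) := by gcongr
  have h4 : φ * ((v * σ) * (-(3 * E * q ^ 2 * r))) ≤ F * (1 * (3 * E * q ^ 2 * D)) := by
    have a1 : (v * σ) * (-(3 * E * q ^ 2 * r)) ≤ (v * σ) * (3 * E * q ^ 2 * D) := by
      rw [← mul_neg]
      gcongr
      exact (neg_le_abs r).trans hr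
    have hD : 0 ≤ D := (abs_nonneg r).trans hr
    calc φ * ((v * σ) * (-(3 * E * q ^ 2 * r))) ≤ φ * ((v * σ) * (3 * E * q ^ 2 * D)) := by gcongr
      _ ≤ F * (1 * (3 * E * q ^ 2 * D)) := by gcongr; linarith
  nlinarith

namespace IsFlow

variable {T N : ℝ} {f : ℝ → ℝ} {u : ℝ → ℝ → ℝ}

set_option maxHeartbeats 2000000 in
/-- Positivity of the slope spreads towards `x = 0`: once the slope is positive on `[α₀, β]`, a
cubic bump on a growing interval stays below it. -/
lemma exists_slope_lower (hu : IsFlow T N f u) {t₀ γ α₀ β η : ℝ} (ht₀ : 0 < t₀) (ht₀T : t₀ < T)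
    (hγ : 0 < γ) (hγα : γ < α₀) (hαβ : α₀ < β) (hβ : β ≤ 1 / 2) (hη : 0 < η)
    (hf' : ∀ x ∈ Icc (0 : ℝ) (1 / 2), 0 ≤ deriv f x)
    (hv : ∀ x ∈ Icc (0 : ℝ) (1 / 2), ∀ t, 0 < t → t < T → 0 ≤ pdx u x t)
    (hinit : ∀ x ∈ Icc α₀ β, η ≤ pdx u x t₀) :
    ∃ E s : ℝ, 0 < E ∧ ∀ t ∈ Ico t₀ T, ∀ x ∈ Icc 0 β, γ + s * (T - t) ≤ x →
      E * ((x - (γ + s * (T - t))) * (β - x)) ^ 3 ≤ pdx u x t := by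
  obtain ⟨F, hF, hfF⟩ := exists_bound_of_periodic hu.diff.continuous hu.force_periodic
  set s : ℝ := (α₀ - γ) / (T - t₀) with hs
  have hs0 : 0 < s := div_pos (by linarith) (by linarith)
  have hsT : s * (T - t₀) = α₀ - γ := div_mul_cancel₀ _ (by linarith)
  set D₀ := β - α₀ with hD₀
  have hD₀0 : 0 < D₀ := by linarith
  set K : ℝ := ((48 + 3 * F + 3 * s) ^ 2 + 1) / (12 * D₀ ^ 2) with hK
  have hKK : (48 + 3 * F + 3 * s) ^ 2 < 12 * D₀ ^ 2 * K := by
    rw [hK, mul_div_cancel₀ _ (by positivity)]; linarith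
  have hK0 : 0 < K := by positivity
  set ε := min η 1 with hε
  have hε0 : 0 < ε := by positivity
  refine ⟨ε * exp (-K * (T - t₀)), s, by positivity, fun t₁ ht₁ x₁ hx₁ hαx => ?_⟩
  set α : ℝ → ℝ := fun t => γ + s * (T - t) with hα
  set q : ℝ → ℝ → ℝ := fun x t => (x - α t) * (β - x) with hq
  set E : ℝ → ℝ := fun t => ε * exp (-K * (t - t₀)) with hE
  have hαd : ∀ t, HasDerivAt α (-s) t := fun t => by
    simpa [hα] using (((hasDerivAt_id t).const_sub T).const_mul s).const_add γ
  have hα0 : ∀ t, t ≤ t₁ → 0 < α t := fun t ht => by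
    have : 0 < s * (T - t) := mul_pos hs0 (by linarith [ht₁.2])
    simp only [hα]; linarith
  have hαle : ∀ t, t₀ ≤ t → α t ≤ α₀ := fun t ht => by
    have : s * (T - t) ≤ s * (T - t₀) := by gcongr
    simp only [hα]; linarith
  have hE0 : ∀ t, 0 < E t := fun t => by positivity
  have hEle : ∀ t, t₀ ≤ t → E t ≤ ε := fun t ht =>
    mul_le_of_le_one_right hε0.le (exp_le_one_iff.2 (by
      have := mul_nonneg hK0.le (sub_nonneg.2 ht)
      linarith))
  have hqx : 0 ≤ q x₁ t₁ := mul_nonneg (by simp only [hα]; linarith) (by linarith [hx₁.2])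
  have hlast : ε * exp (-K * (T - t₀)) * q x₁ t₁ ^ 3 ≤ E t₁ * q x₁ t₁ ^ 3 := by
    simp only [hE]
    have := ht₁.2.le
    gcongr ?_ * ?_ * ?_
    refine exp_le_exp.2 ?_
    rw [neg_mul, neg_mul]
    gcongr
  refine hlast.trans (le_of_forall_pos_le_add fun δ hδ => ?_)
  have hT1 : ∀ {t}, t ∈ Ioc t₀ t₁ → t < T := fun ht => ht.2.trans_lt ht₁.2
  have hcont : Continuous fun p : ℝ × ℝ => E p.2 * q p.1 p.2 ^ 3 := by
    simp only [hE, hq, hα]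
    fun_prop
  have hEt : E t₀ = ε := by simp [hE]
  have hαt : α t₀ = α₀ := by simp only [hα]; linarith
  have hbump_t : ∀ x t, HasDerivAt (fun s => E s * q x s ^ 3) (E t * (-K * q x t ^ 3
      + 3 * q x t ^ 2 * (-(-s) * (β - x) + 0 * (x - α t)))) t := fun x t =>
    hasDerivAt_bump_t ε K t₀ x (hαd t) (hasDerivAt_const t β)
  clear_value E α
  have hmain := parabolic_pos (a := 0) (b := β) (t₀ := t₀) (t₁ := t₁)
    (w := fun x t => pdx u x t - E t * q x t ^ 3 + δ)
    (wx := fun x t => pdxx u x t - 3 * E t * q x t ^ 2 * (α t + β - 2 * x))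
    (wxx := fun x t => pdxx (pdx u) x t
      - E t * (6 * q x t * (α t + β - 2 * x) ^ 2 - 6 * q x t ^ 2))
    (wt := fun x t => pdt (pdx u) x t
      - E t * (-K * q x t ^ 3 + 3 * q x t ^ 2 * (-(-s) * (β - x) + 0 * (x - α t))))
    (by
      exact (hu.continuousOn_pdx ht₀ ht₁.2).sub hcont.continuousOn |>.add continuousOn_const)
    (fun x hx => by
      have h1 : E t₀ * q x t₀ ^ 3 ≤ pdx u x t₀ := by
        rw [hEt]
        simp only [hq, hαt]
        rcases le_total x α₀ with h | h
        · have h2 : (x - α₀) * (β - x) ≤ 0 :=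
            mul_nonpos_of_nonpos_of_nonneg (by linarith) (by linarith [hx.2])
          have h3 : ((x - α₀) * (β - x)) ^ 3 ≤ 0 := Odd.pow_nonpos (by decide) h2
          exact (mul_nonpos_of_nonneg_of_nonpos hε0.le h3).trans
            (hv x ⟨hx.1, hx.2.trans hβ⟩ t₀ ht₀ ht₀T)
        · have h2 : 0 ≤ (x - α₀) * (β - x) := mul_nonneg (by linarith) (by linarith [hx.2])
          have h3 : (x - α₀) * (β - x) ≤ 1 :=
            mul_le_one₀ (by linarith [hx.2]) (by linarith [hx.2]) (by linarith)
          calc ε * ((x - α₀) * (β - x)) ^ 3 ≤ ε * 1 := by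
                gcongr; exact pow_le_one₀ h2 h3
            _ ≤ η := by rw [mul_one]; exact min_le_left _ _
            _ ≤ _ := hinit x ⟨h, hx.2⟩
      linarith)
    (fun t ht h => absurd h (not_le.2 (by
      have h2 : q 0 t ≤ 0 :=
        mul_nonpos_of_nonpos_of_nonneg (by linarith [hα0 t ht.2]) (by linarith)
      have h3 : q 0 t ^ 3 ≤ 0 := Odd.pow_nonpos (by decide) h2
      have h4 := mul_nonpos_of_nonneg_of_nonpos (hE0 t).le h3
      have h5 := hv 0 ⟨le_rfl, by norm_num⟩ t (ht₀.trans ht.1) (hT1 ht)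
      linarith)))
    (fun t ht h => absurd h (not_le.2 (by
      have h2 : q β t = 0 := by simp [hq]
      have h5 := hv β ⟨by linarith, hβ⟩ t (ht₀.trans ht.1) (hT1 ht)
      rw [h2]
      norm_num
      linarith)))
    (fun x _ t ht => ((hu.hasDerivAt_xx (ht₀.trans ht.1) (hT1 ht)).fun_sub
      (hasDerivAt_bump (E t) (α t) β x)).add_const δ)
    (fun x _ t ht => (hu.smooth.pdx.pdx.hasDerivAt_pdx (ht₀.trans ht.1) (hT1 ht)).fun_sub
      (hasDerivAt_bump_x (E t) (α t) β x))
    (fun x _ t ht => ((hu.smooth.pdx.hasDerivAt_pdt (ht₀.trans ht.1) (hT1 ht)).fun_sub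
      (hbump_t x t)).add_const δ)
    (fun x hx t ht hw hwx hwxx => by
      have hxI : x ∈ Icc (0 : ℝ) (1 / 2) := ⟨hx.1.le, hx.2.le.trans hβ⟩
      have ht0 := ht₀.trans ht.1
      have hv0 := hv x hxI t ht0 (hT1 ht)
      have hEq : 0 < E t * q x t ^ 3 := by linarith
      have hq3 : 0 < q x t ^ 3 := pos_of_mul_pos_right hEq (hE0 t).le
      have hq0 : 0 < q x t := (Odd.pow_pos_iff (by decide)).1 hq3
      have hxα : 0 < x - α t := pos_of_mul_pos_left hq0 (by linarith [hx.2])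
      have hαt := hα0 t ht.2
      have hαt' := hαle t ht.1.le
      have hsub := bump_subsolution (E := E t) (q := q x t) (v := pdx u x t) (vx := pdxx u x t)
        (vxx := pdxx (pdx u) x t) (r := α t + β - 2 * x) (D := β - α t) (D₀ := D₀) (s := s)
        (F := F) (φ := f x) (K := K) (qt := -(-s) * (β - x) + 0 * (x - α t))
        (hE0 t) ((hEle t ht.1.le).trans (min_le_right _ _)) hq0
        (mul_le_one₀ (by linarith [hx.2]) (by linarith [hx.2]) (by linarith)) hv0 (by linarith)
        (by simp only [hq]; ring) (abs_le.2 ⟨by linarith [hx.2], by linarith [hx.2]⟩)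
        (by linarith) (by linarith) (by
          have : s * (β - x) ≤ s * 1 := by gcongr; linarith [hx.1]
          linarith) (hu.force_pos x).le (hfF x)
        hD₀0.le (by linarith) hKK
      rw [hu.pdt_pdx ht0 (hT1 ht)]
      have h1 : 0 ≤ N * pdx u x t / u x t ^ 2 :=
        div_nonneg (mul_nonneg hu.nonneg hv0) (sq_nonneg _)
      have h2 : 0 ≤ deriv f x * √(pdx u x t ^ 2 + 1) := mul_nonneg (hf' x hxI) (Real.sqrt_nonneg _)
      linarith)
    x₁ hx₁ t₁ ⟨ht₁.1, le_rfl⟩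
  linarith

set_option maxHeartbeats 2000000 in
/-- Interior estimate for the slope: the tangent angle stays away from `π/2`. -/
lemma exists_slope_upper (hu : IsFlow T N f u) {F t₀ c d m : ℝ} (ht₀ : 0 < t₀) (ht₀T : t₀ < T)
    (hF : 0 < F) (hfF : ∀ x, f x ≤ F) (hc : 0 ≤ c) (hd : d ≤ 1 / 2)
    (hcd : 2 * (F * (T - t₀)) < d - c) (hm : 0 < m)
    (hum : ∀ x ∈ Icc c d, ∀ t ∈ Ico t₀ T, m ≤ u x t)
    (hv : ∀ x ∈ Icc (0 : ℝ) (1 / 2), ∀ t, 0 < t → t < T → 0 ≤ pdx u x t) :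
    ∃ E : ℝ, 0 < E ∧ ∀ t ∈ Ico t₀ T, ∀ x ∈ Icc (c + F * (T - t₀)) (d - F * (T - t₀)),
      arctan (pdx u x t) ≤ π / 2
        - E * ((x - (c + F * (T - t₀))) * ((d - F * (T - t₀)) - x)) ^ 3 := by
  obtain ⟨C₂, hC₂⟩ := (isCompact_Icc (a := c) (b := d)).bddAbove_image
    (hu.diff.continuous_deriv le_rfl).continuousOn
  have hTt : 0 < T - t₀ := by linarith
  have hcd' : c ≤ d := by linarith [mul_pos hF hTt]
  obtain ⟨V, hV⟩ := (isCompact_Icc (a := c) (b := d)).bddAbove_image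
    (f := fun x => pdx u x t₀) (by
      refine (hu.continuousOn_pdx (a := c) (b := d) (t₁ := t₀) ht₀ ht₀T).comp
        (f := fun x : ℝ => (x, t₀)) (by fun_prop) (fun x hx => ⟨hx, by simp⟩))
  set C₁ := N / m ^ 2 with hC₁
  have hC₁0 : 0 ≤ C₁ := div_nonneg hu.nonneg (sq_nonneg m)
  set K : ℝ := 7 + C₁ + max C₂ 0 with hK
  have hK0 : 0 < K := by positivity
  have hVlt := arctan_lt_pi_div_two V
  set ε := min 1 ((π / 2 - arctan V) / 2) with hε
  have hε0 : 0 < ε := lt_min one_pos (by linarith)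
  refine ⟨ε * exp (-K * (T - t₀)), by positivity, fun t₁ ht₁ x₁ hx₁ => ?_⟩
  set α : ℝ → ℝ := fun t => c + F * (t - t₀) with hα
  set β : ℝ → ℝ := fun t => d - F * (t - t₀) with hβ
  set q : ℝ → ℝ → ℝ := fun x t => (x - α t) * (β t - x) with hq
  set E : ℝ → ℝ := fun t => ε * exp (-K * (t - t₀)) with hE
  have hαd : ∀ t, HasDerivAt α F t := fun t => by
    simpa [hα] using (((hasDerivAt_id t).sub_const t₀).const_mul F).const_add c
  have hβd : ∀ t, HasDerivAt β (-F) t := fun t => by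
    simpa [hβ] using (((hasDerivAt_id t).sub_const t₀).const_mul F).const_sub d
  have hE0 : ∀ t, 0 < E t := fun t => by positivity
  have hEle : ∀ t, t₀ ≤ t → E t ≤ ε := fun t ht =>
    mul_le_of_le_one_right hε0.le (exp_le_one_iff.2 (by
      have := mul_nonneg hK0.le (sub_nonneg.2 ht)
      linarith))
  have hFt : ∀ t ∈ Icc t₀ t₁, 0 ≤ F * (t - t₀) ∧ F * (t - t₀) ≤ F * (T - t₀) := fun t ht =>
    ⟨mul_nonneg hF.le (by linarith [ht.1]), by gcongr; linarith [ht.2, ht₁.2]⟩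
  have hT1 : ∀ {t}, t ∈ Ioc t₀ t₁ → t < T := fun ht => ht.2.trans_lt ht₁.2
  have hcont : Continuous fun p : ℝ × ℝ => E p.2 * q p.1 p.2 ^ 3 := by
    simp only [hE, hq, hα, hβ]
    fun_prop
  have hEt : E t₀ = ε := by simp [hE]
  have hqt : ∀ x, q x t₀ = (x - c) * (d - x) := fun x => by simp [hq, hα, hβ]
  have hbump_t : ∀ x t, HasDerivAt (fun s => E s * q x s ^ 3) (E t * (-K * q x t ^ 3
      + 3 * q x t ^ 2 * (-F * (β t - x) + -F * (x - α t)))) t := fun x t =>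
    hasDerivAt_bump_t ε K t₀ x (hαd t) (hβd t)
  have hαc : ∀ t ∈ Icc t₀ t₁, c ≤ α t := fun t ht => by
    have := (hFt t ht).1; simp only [hα]; linarith
  have hβd' : ∀ t ∈ Icc t₀ t₁, β t ≤ d := fun t ht => by
    have := (hFt t ht).1; simp only [hβ]; linarith
  have hαβ : ∀ t ∈ Icc t₀ t₁, α t < β t := fun t ht => by
    have := (hFt t ht).2; simp only [hα, hβ]; linarith
  have hFt' := hFt t₁ ⟨ht₁.1, le_rfl⟩
  have hlast : ε * exp (-K * (T - t₀)) *
      ((x₁ - (c + F * (T - t₀))) * ((d - F * (T - t₀)) - x₁)) ^ 3 ≤ E t₁ * q x₁ t₁ ^ 3 := by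
    have h1 := hx₁.1
    have h2 := hx₁.2
    have h3 : 0 ≤ x₁ - (c + F * (T - t₀)) := by linarith
    have h4 : 0 ≤ d - F * (T - t₀) - x₁ := by linarith
    simp only [hE, hq]
    gcongr ε * ?_ * (?_ * ?_) ^ 3
    · refine exp_le_exp.2 ?_
      rw [neg_mul, neg_mul]
      gcongr
      exact ht₁.2.le
    · linarith
    · simp only [hα]; linarith
    · simp only [hβ]; linarith
  clear_value E α β
  have hmain := parabolic_pos (a := c) (b := d) (t₀ := t₀) (t₁ := t₁)
    (w := fun x t => π / 2 - E t * q x t ^ 3 - arctan (pdx u x t))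
    (wx := fun x t => -(3 * E t * q x t ^ 2 * (α t + β t - 2 * x))
      - pdxx u x t / ((pdx u x t) ^ 2 + 1))
    (wxx := fun x t => -(E t * (6 * q x t * (α t + β t - 2 * x) ^ 2 - 6 * q x t ^ 2))
      - (pdxx (pdx u) x t / ((pdx u x t) ^ 2 + 1)
        - 2 * pdx u x t * (pdxx u x t) ^ 2 / ((pdx u x t) ^ 2 + 1) ^ 2))
    (wt := fun x t => -(E t * (-K * q x t ^ 3
        + 3 * q x t ^ 2 * (-F * (β t - x) + -F * (x - α t))))
      - pdt (pdx u) x t / ((pdx u x t) ^ 2 + 1))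
    (by
      refine ContinuousOn.sub (continuousOn_const.sub hcont.continuousOn) ?_
      exact continuous_arctan.comp_continuousOn (hu.continuousOn_pdx ht₀ ht₁.2))
    (fun x hx => by
      have hqt := hqt x
      have h2 : 0 ≤ q x t₀ := hqt ▸ mul_nonneg (by linarith [hx.1]) (by linarith [hx.2])
      have h3 : q x t₀ ≤ 1 := by
        rw [hqt]
        exact mul_le_one₀ (by linarith [hx.2]) (by linarith [hx.2]) (by linarith [hx.1])
      have h4 : E t₀ * q x t₀ ^ 3 ≤ (π / 2 - arctan V) / 2 := by
        rw [hEt]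
        exact (mul_le_of_le_one_right hε0.le (pow_le_one₀ h2 h3)).trans (min_le_right _ _)
      have h5 : arctan (pdx u x t₀) ≤ arctan V := arctan_le_arctan_iff.2 (hV ⟨x, hx, rfl⟩)
      linarith)
    (fun t ht h => absurd h (not_le.2 (by
      have hαc' := hαc t ⟨ht.1.le, ht.2⟩
      have hαβ' := hαβ t ⟨ht.1.le, ht.2⟩
      have h2 : q c t ≤ 0 :=
        mul_nonpos_of_nonpos_of_nonneg (by linarith) (by linarith)
      have h3 : q c t ^ 3 ≤ 0 := Odd.pow_nonpos (by decide) h2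
      have h4 := mul_nonpos_of_nonneg_of_nonpos (hE0 t).le h3
      linarith [arctan_lt_pi_div_two (pdx u c t)])))
    (fun t ht h => absurd h (not_le.2 (by
      have hβd'' := hβd' t ⟨ht.1.le, ht.2⟩
      have hαβ' := hαβ t ⟨ht.1.le, ht.2⟩
      have h2 : q d t ≤ 0 :=
        mul_nonpos_of_nonneg_of_nonpos (by linarith) (by linarith)
      have h3 : q d t ^ 3 ≤ 0 := Odd.pow_nonpos (by decide) h2
      have h4 := mul_nonpos_of_nonneg_of_nonpos (hE0 t).le h3
      linarith [arctan_lt_pi_div_two (pdx u d t)])))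
    (fun x _ t ht => by
      have h := ((hasDerivAt_bump (E t) (α t) (β t) x).const_sub (π / 2)).fun_sub
        (hu.hasDerivAt_xx (x := x) (ht₀.trans ht.1) (hT1 ht)).arctan
      refine h.congr_deriv ?_
      rw [add_comm 1 (pdx u x t ^ 2)]
      ring)
    (fun x _ t ht => by
      have hp : (pdx u x t) ^ 2 + 1 ≠ 0 := by positivity
      have h1 := hu.hasDerivAt_xx (x := x) (ht₀.trans ht.1) (hT1 ht)
      have h2 : HasDerivAt (fun y => pdxx u y t) (pdxx (pdx u) x t) x :=
        hu.smooth.pdx.pdx.hasDerivAt_pdx (ht₀.trans ht.1) (hT1 ht)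
      have h3 : HasDerivAt (fun y => (pdx u y t) ^ 2 + 1) (2 * pdx u x t * pdxx u x t) x := by
        simpa using (h1.fun_pow 2).add_const 1
      refine ((hasDerivAt_bump_x (E t) (α t) (β t) x).fun_neg.fun_sub
        (h2.fun_div h3 hp)).congr_deriv ?_
      simp only [hq]
      field_simp)
    (fun x _ t ht => by
      have h := ((hbump_t x t).const_sub (π / 2)).fun_sub
        (hu.smooth.pdx.hasDerivAt_pdt (x := x) (ht₀.trans ht.1) (hT1 ht)).arctan
      refine h.congr_deriv ?_
      rw [add_comm 1 (pdx u x t ^ 2)]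
      ring)
    (fun x hx t ht hw hwx hwxx => by
      have hxI : x ∈ Icc (0 : ℝ) (1 / 2) := ⟨hc.trans hx.1.le, hx.2.le.trans hd⟩
      have hxI' := Ioo_subset_Icc_self hx
      have ht0 := ht₀.trans ht.1
      have hv0 := hv x hxI t ht0 (hT1 ht)
      have hEq : 0 < E t * q x t ^ 3 := by linarith [arctan_lt_pi_div_two (pdx u x t)]
      have hq3 : 0 < q x t ^ 3 := pos_of_mul_pos_right hEq (hE0 t).le
      have hq0 : 0 < q x t := (Odd.pow_pos_iff (by decide)).1 hq3
      have hαβ := hαβ t ⟨ht.1.le, ht.2⟩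
      have hαc := hαc t ⟨ht.1.le, ht.2⟩
      have hβd' := hβd' t ⟨ht.1.le, ht.2⟩
      have hxα : 0 < x - α t := by
        by_contra! h
        exact absurd hq0 (not_lt.2 (mul_nonpos_of_nonpos_of_nonneg h (by linarith)))
      have hxβ : 0 < β t - x := pos_of_mul_pos_right hq0 hxα.le
      have hp : 0 < (pdx u x t) ^ 2 + 1 := by positivity
      have hσ : 1 / √((pdx u x t) ^ 2 + 1) ≤ E t * q x t ^ 3 := by
        rw [add_comm, ← cos_arctan, show arctan (pdx u x t) = π / 2 - E t * q x t ^ 3 by linarith,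
          cos_pi_div_two_sub]
        exact sin_le hEq.le
      have humx := hum x hxI' t ⟨ht.1.le, hT1 ht⟩
      have hsup := bump_supersolution (E := E t) (q := q x t) (v := pdx u x t) (vx := pdxx u x t)
        (A := pdxx (pdx u) x t / ((pdx u x t) ^ 2 + 1)
          - 2 * pdx u x t * (pdxx u x t) ^ 2 / ((pdx u x t) ^ 2 + 1) ^ 2)
        (B := N * pdx u x t / (u x t) ^ 2)
        (r := α t + β t - 2 * x) (D := β t - α t) (F := F) (φ := f x) (φ' := deriv f x) (K := K)
        (C₁ := C₁) (C₂ := max C₂ 0)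
        (hE0 t) ((hEle t ht.1.le).trans (min_le_left _ _)) hq0
        (mul_le_one₀ (by linarith) hxβ.le (by linarith)) hv0 hσ (by linarith)
        (by
          have : pdxx u x t / ((pdx u x t) ^ 2 + 1)
            = -(3 * E t * q x t ^ 2 * (α t + β t - 2 * x)) := by linarith
          rw [div_eq_iff hp.ne'] at this
          exact this)
        (abs_le.2 ⟨by linarith, by linarith⟩) (hu.force_pos x).le (hfF x)
        ((hC₂ ⟨x, hxI', rfl⟩).trans (le_max_left _ _)) (le_max_right _ _) hC₁0
        (by
          rw [hC₁, div_mul_eq_mul_div]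
          have := mul_nonneg hu.nonneg hv0
          gcongr)
        (by linarith)
      rw [hu.pdt_pdx ht0 (hT1 ht)]
      have e : E t * (K * q x t ^ 3 + 3 * q x t ^ 2 * (F * (β t - α t)))
        = -(E t * (-K * q x t ^ 3
        + 3 * q x t ^ 2 * (-F * (β t - x) + -F * (x - α t)))) := by ring
      linarith)
    x₁ ⟨by linarith [hx₁.1, mul_pos hF hTt], by linarith [hx₁.2, mul_pos hF hTt]⟩
    t₁ ⟨ht₁.1, le_rfl⟩
  linarith

end IsFlow

/-- A bounded function which can increase only at a controlled rate, up to arbitrarily small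
errors, has a limit. -/
lemma exists_tendsto_of_le_add {h : ℝ → ℝ} {τ T M : ℝ} (hτ : τ < T)
    (h0 : ∀ t ∈ Ico τ T, 0 ≤ h t) (hM : ∀ t ∈ Ico τ T, h t ≤ M)
    (hinc : ∀ δ > 0, ∃ C, ∀ t₁ t, τ ≤ t₁ → t₁ ≤ t → t < T → h t ≤ h t₁ + δ + C * (t - t₁)) :
    ∃ L, Tendsto h (𝓝[<] T) (𝓝 L) := by
  have hev : ∀ᶠ t in 𝓝[<] T, t ∈ Ico τ T := Ico_mem_nhdsLT hτ
  have hb : IsBoundedUnder (· ≥ ·) (𝓝[<] T) h := ⟨0, hev.mono fun t ht => h0 t ht⟩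
  have hc : IsCoboundedUnder (· ≥ ·) (𝓝[<] T) h :=
    IsBoundedUnder.isCoboundedUnder_ge ⟨M, hev.mono fun t ht => hM t ht⟩
  refine ⟨liminf h (𝓝[<] T), tendsto_order.2 ⟨fun a ha => eventually_lt_of_lt_liminf ha hb,
    fun a ha => ?_⟩⟩
  set l := liminf h (𝓝[<] T)
  obtain ⟨ε, hε, rfl⟩ : ∃ ε > 0, a = l + 3 * ε := ⟨(a - l) / 3, by linarith, by ring⟩
  obtain ⟨C, hC⟩ := hinc ε hε
  have hfr := frequently_lt_of_liminf_lt hc (show l < l + ε by linarith)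
  have hCpos : 0 < |C| + 1 := by positivity
  obtain ⟨t₁, hlt, ht₁, ht₁'⟩ := (hfr.and_eventually (hev.and (Ico_mem_nhdsLT
    (show T - ε / (|C| + 1) < T by linarith [div_pos hε hCpos])))).exists
  filter_upwards [Ico_mem_nhdsLT ht₁.2] with t ht
  have h1 := hC t₁ t ht₁.1 ht.1 ht.2
  have h2 : (t - t₁) * (|C| + 1) ≤ ε := by
    rw [← le_div_iff₀ hCpos]
    linarith [ht₁'.1, ht.2]
  have h3 : C * (t - t₁) ≤ (|C| + 1) * (t - t₁) :=
    mul_le_mul_of_nonneg_right (by linarith [le_abs_self C]) (by linarith [ht.1])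
  linarith

namespace IsFlow

variable {T N : ℝ} {f : ℝ → ℝ} {u : ℝ → ℝ → ℝ}

/-- Mean value estimate from below for a spatial slice of the solution. -/
lemma mul_sub_le (hu : IsFlow T N f u) {t x y κ : ℝ} (h0 : 0 < t) (h1 : t < T) (hxy : x ≤ y)
    (h : ∀ z ∈ Ioo x y, κ ≤ pdx u z t) : κ * (y - x) ≤ u y t - u x t := by
  rcases hxy.eq_or_lt with rfl | hlt
  · simp
  obtain ⟨z, hz, hzs⟩ := exists_hasDerivAt_eq_slope (fun x => u x t) (fun x => pdx u x t) hlt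
    (fun z _ => (hu.hasDerivAt_x h0 h1).continuousAt.continuousWithinAt)
    (fun z _ => hu.hasDerivAt_x h0 h1)
  have := h z hz
  rw [hzs, le_div_iff₀ (by linarith)] at this
  exact this

/-- Mean value estimate from above for a spatial slice of the solution. -/
lemma le_mul_sub (hu : IsFlow T N f u) {t x y κ : ℝ} (h0 : 0 < t) (h1 : t < T) (hxy : x ≤ y)
    (h : ∀ z ∈ Ioo x y, pdx u z t ≤ κ) : u y t - u x t ≤ κ * (y - x) := by
  rcases hxy.eq_or_lt with rfl | hlt
  · simp
  obtain ⟨z, hz, hzs⟩ := exists_hasDerivAt_eq_slope (fun x => u x t) (fun x => pdx u x t) hlt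
    (fun z _ => (hu.hasDerivAt_x h0 h1).continuousAt.continuousWithinAt)
    (fun z _ => hu.hasDerivAt_x h0 h1)
  have := h z hz
  rw [hzs, div_le_iff₀ (by linarith)] at this
  exact this

lemma pdx_nonneg (hu : IsFlow T N f u)
    (hmono : ∀ t, 0 ≤ t → t < T → MonotoneOn (fun x => u x t) (Icc 0 (1 / 2))) :
    ∀ x ∈ Icc (0 : ℝ) (1 / 2), ∀ t, 0 < t → t < T → 0 ≤ pdx u x t := by
  intro x hx t h0 h1
  have hd := (hu.hasDerivAt_x (x := x) h0 h1).hasDerivWithinAt (s := Icc 0 (1 / 2))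
  rw [← hd.derivWithin (uniqueDiffOn_Icc (by norm_num) x hx)]
  exact (hmono t h0.le h1).derivWithin_nonneg

/-- Away from the integers the solution stays bounded below up to the final time. -/
lemma exists_eventual_lower_bound (hu : IsFlow T N f u) (hT : 0 < T)
    (hmono : ∀ t, 0 ≤ t → t < T → MonotoneOn (fun x => u x t) (Icc 0 (1 / 2)))
    (hf' : ∀ x ∈ Icc (0 : ℝ) (1 / 2), 0 ≤ deriv f x) (h01 : u 0 0 < u (1 / 2) 0)
    {c : ℝ} (hc : 0 < c) (hc2 : c ≤ 1 / 2) :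
    ∃ m τ, 0 < m ∧ 0 < τ ∧ τ < T ∧ ∀ t ∈ Ico τ T, m ≤ u c t := by
  have hv := hu.pdx_nonneg hmono
  obtain ⟨t₀, ⟨ht₀, ht₀T⟩, hlt⟩ : ∃ t₀ ∈ Ioo 0 T, u 0 t₀ < u (1 / 2) t₀ := by
    have hcx : ∀ x, Tendsto (fun t => u x t) (𝓝[>] 0) (𝓝 (u x 0)) := fun x => by
      have h1 : ContinuousWithinAt (fun t => u x t) (Ico 0 T) 0 :=
        (hu.cont (x, 0) ⟨le_rfl, hT⟩).comp (f := fun s : ℝ => (x, s)) (s := Ico 0 T)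
          (by fun_prop) (fun s hs => hs)
      refine h1.tendsto.mono_left ?_
      rw [nhdsWithin_le_iff]
      exact mem_of_superset (Ioo_mem_nhdsGT hT) Ioo_subset_Ico_self
    obtain ⟨t, h1, h2⟩ := (((hcx 0).eventually_lt (hcx (1 / 2)) h01).and
      (Ioo_mem_nhdsGT hT)).exists
    exact ⟨t, h2, h1⟩
  obtain ⟨x₁, hx₁, hslope⟩ := exists_hasDerivAt_eq_slope (fun x => u x t₀) (fun x => pdx u x t₀)
    (show (0 : ℝ) < 1 / 2 by norm_num)
    (fun z _ => (hu.hasDerivAt_x ht₀ ht₀T).continuousAt.continuousWithinAt)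
    (fun z _ => hu.hasDerivAt_x ht₀ ht₀T)
  have hpos : 0 < pdx u x₁ t₀ := by
    rw [hslope]; exact div_pos (by linarith) (by norm_num)
  obtain ⟨ρ, hρ, hball⟩ := Metric.eventually_nhds_iff.1
    ((hu.hasDerivAt_xx (x := x₁) ht₀ ht₀T).continuousAt.eventually_const_lt
      (show pdx u x₁ t₀ / 2 < pdx u x₁ t₀ by linarith))
  obtain ⟨r, hr0, hr⟩ := exists_between
    (show 0 < min ρ (min x₁ (1 / 2 - x₁)) from lt_min hρ (lt_min hx₁.1 (by linarith [hx₁.2])))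
  obtain ⟨hrρ, hr⟩ := lt_min_iff.1 hr
  obtain ⟨hrx, hrx'⟩ := lt_min_iff.1 hr
  obtain ⟨c', hc'0, hc'c, hc'α⟩ : ∃ c', 0 < c' ∧ c' ≤ c ∧ c' ≤ x₁ - r :=
    ⟨min c (x₁ - r), lt_min hc (by linarith), min_le_left _ _, min_le_right _ _⟩
  obtain ⟨E, s, hE, hlow⟩ := hu.exists_slope_lower (t₀ := t₀) (γ := c' / 4) (α₀ := x₁ - r)
    (β := x₁ + r) (η := pdx u x₁ t₀ / 2) ht₀ ht₀T (by linarith) (by linarith) (by linarith)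
    (by linarith) (by linarith) hf' hv (fun x hx => (hball (by
      rw [Real.dist_eq]
      exact (abs_le.2 ⟨by linarith [hx.1], by linarith [hx.2]⟩ : |x - x₁| ≤ r).trans_lt hrρ)).le)
  set κ := E * (c' / 4 * (x₁ + r - c')) ^ 3 with hκ
  have hgap : 0 < x₁ + r - c' := by linarith
  have hs0 : 0 < |s| + 1 := by positivity
  have hκ0 : 0 < κ := by positivity
  have hdiv : 0 < c' / 4 / (|s| + 1) := by positivity
  refine ⟨κ * (c' / 4), max t₀ (T - c' / 4 / (|s| + 1)), by positivity,
    ht₀.trans_le (le_max_left _ _), max_lt ht₀T (sub_lt_self _ hdiv), fun t ht => ?_⟩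
  have ht₀t : t₀ ≤ t := (le_max_left _ _).trans ht.1
  have ht0 : 0 < t := ht₀.trans_le ht₀t
  have hst : s * (T - t) ≤ c' / 4 := by
    have h1 : T - t ≤ c' / 4 / (|s| + 1) := by linarith [(le_max_right _ _).trans ht.1]
    rw [le_div_iff₀ hs0] at h1
    have h2 : s * (T - t) ≤ (|s| + 1) * (T - t) :=
      mul_le_mul_of_nonneg_right (by linarith [le_abs_self s]) (by linarith [ht.2])
    linarith
  have h1 := hu.mul_sub_le (x := 3 * c' / 4) (y := c') (κ := κ) ht0 ht.2 (by linarith)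
    (fun z hz => by
      refine le_trans ?_ (hlow t ⟨ht₀t, ht.2⟩ z ⟨by linarith [hz.1], by linarith [hz.2]⟩
        (by linarith [hz.1]))
      rw [hκ]
      have := hz.1
      have := hz.2
      gcongr E * (?_ * ?_) ^ 3
      all_goals linarith)
  have h2 := hu.pos (3 * c' / 4) t ht0.le ht.2
  have h3 := hmono t ht0.le ht.2 ⟨hc'0.le, hc'c.trans hc2⟩ ⟨hc.le, hc2⟩ hc'c
  dsimp only at h3
  linarith

/-- Away from the integers the slope stays bounded up to the final time. -/
lemma exists_eventual_slope_bound (hu : IsFlow T N f u) (hT : 0 < T)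
    (hmono : ∀ t, 0 ≤ t → t < T → MonotoneOn (fun x => u x t) (Icc 0 (1 / 2)))
    (hf' : ∀ x ∈ Icc (0 : ℝ) (1 / 2), 0 ≤ deriv f x) (h01 : u 0 0 < u (1 / 2) 0)
    {x₀ : ℝ} (hx₀ : 0 < x₀) (hx₀' : x₀ < 1 / 2) :
    ∃ L ρ τ, 0 < ρ ∧ 0 < τ ∧ τ < T ∧ ∀ t ∈ Ico τ T, ∀ x ∈ Icc x₀ (x₀ + ρ), pdx u x t ≤ L := by
  have hv := hu.pdx_nonneg hmono
  obtain ⟨F, hF, hfF⟩ := exists_bound_of_periodic hu.diff.continuous hu.force_periodic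
  obtain ⟨m, τ, hm, hτ, hτT, hlow⟩ := hu.exists_eventual_lower_bound hT hmono hf' h01
    (c := x₀ / 2) (by linarith) (by linarith)
  obtain ⟨r, hr0, hr1, hr2⟩ : ∃ r, 0 < r ∧ r ≤ x₀ / 2 ∧ r ≤ (1 / 2 - x₀) / 2 :=
    ⟨min (x₀ / 2) ((1 / 2 - x₀) / 2), lt_min (by linarith) (by linarith), min_le_left _ _,
      min_le_right _ _⟩
  have hrF : 0 < r / 4 / F := by positivity
  set t₀ := max τ (T - r / 4 / F) with ht₀d
  have hτt₀ : τ ≤ t₀ := le_max_left _ _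
  have ht₀T : t₀ < T := max_lt hτT (by linarith)
  have hFT : F * (T - t₀) ≤ r / 4 := by
    have : T - t₀ ≤ r / 4 / F := by linarith [le_max_right τ (T - r / 4 / F)]
    rw [le_div_iff₀ hF] at this
    linarith
  have hd : x₀ / 2 + 1 / 4 ≤ 1 / 2 := by linarith
  obtain ⟨E, hE, hang⟩ := hu.exists_slope_upper (c := x₀ / 2) (d := x₀ / 2 + 1 / 4) (m := m)
    (hτ.trans_le hτt₀) ht₀T hF hfF (by linarith) hd (by linarith) hm
    (fun x hx t ht => (hlow t ⟨hτt₀.trans ht.1, ht.2⟩).trans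
      (hmono t (hτ.le.trans (hτt₀.trans ht.1)) ht.2 ⟨by linarith, by linarith⟩
        ⟨by linarith [hx.1], by linarith [hx.2]⟩ hx.1)) hv
  set κ := E * (r / 2 * (r / 2)) ^ 3 with hκ
  have hκ0 : 0 < κ := by positivity
  refine ⟨tan (π / 2 - κ), r / 4, t₀, by positivity, hτ.trans_le hτt₀, ht₀T,
    fun t ht x hx => ?_⟩
  have hx1 := hx.1
  have hx2 := hx.2
  have h1 := hang t ht x ⟨by linarith, by linarith⟩
  have h2 : κ ≤ E * ((x - (x₀ / 2 + F * (T - t₀)))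
      * ((x₀ / 2 + 1 / 4 - F * (T - t₀)) - x)) ^ 3 := by
    rw [hκ]
    gcongr E * (?_ * ?_) ^ 3
    all_goals linarith
  have h3 : 0 ≤ arctan (pdx u x t) := arctan_nonneg.2
    (hv x ⟨by linarith, by linarith⟩ t (hτ.trans_le (hτt₀.trans ht.1)) ht.2)
  have hpi := Real.pi_pos
  rw [← arctan_le_arctan_iff, arctan_tan (by linarith) (by linarith)]
  linarith

/-- A solution with a Lipschitz bound at a point can grow there only at a controlled rate. -/
lemma exists_growth_bound (hu : IsFlow T N f u) {x₀ ρ₀ L τ M F : ℝ} (hρ₀ : 0 < ρ₀) (hτ : 0 < τ)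
    (hM0 : 0 < M) (hM : ∀ x t, 0 ≤ t → t < T → u x t ≤ M) (hF : 0 ≤ F) (hfF : ∀ x, f x ≤ F)
    (hL : ∀ t ∈ Ico τ T, ∀ x, |x - x₀| ≤ ρ₀ → u x t ≤ u x₀ t + L * |x - x₀|)
    {δ : ℝ} (hδ : 0 < δ) :
    ∃ C, ∀ t₁ t, τ ≤ t₁ → t₁ ≤ t → t < T → u x₀ t ≤ u x₀ t₁ + δ + C * (t - t₁) := by
  have hLpos : 0 < |L| + 1 := by positivity
  obtain ⟨ρ, hρ0, hρ1, hρ2⟩ : ∃ ρ, 0 < ρ ∧ ρ ≤ ρ₀ ∧ ρ ≤ δ / 2 / (|L| + 1) :=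
    ⟨min ρ₀ (δ / 2 / (|L| + 1)), lt_min hρ₀ (by positivity), min_le_left _ _, min_le_right _ _⟩
  rw [le_div_iff₀ hLpos] at hρ2
  set K := M / ρ ^ 2 with hK
  have hK0 : 0 < K := by positivity
  have hKρ : K * ρ ^ 2 = M := div_mul_cancel₀ _ (by positivity)
  set C := 2 * K + F * √((2 * K * ρ) ^ 2 + 1) + 1 with hC
  refine ⟨C, fun t₁ t hτt₁ ht₁t htT => ?_⟩
  have h0 : 0 < t₁ := hτ.trans_le hτt₁
  have hT1 : ∀ {s}, s ∈ Ioc t₁ t → s < T := fun hs => hs.2.trans_lt htT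
  have hC0 : 0 ≤ C := by positivity
  have hu₀ := hu.pos x₀ t₁ h0.le (ht₁t.trans_lt htT)
  have hmain := parabolic_pos (a := x₀ - ρ) (b := x₀ + ρ) (t₀ := t₁) (t₁ := t)
    (w := fun x s => u x₀ t₁ + δ + K * (x - x₀) ^ 2 + C * (s - t₁) - u x s)
    (wx := fun x s => K * (2 * (x - x₀)) - pdx u x s)
    (wxx := fun x s => K * 2 - pdxx u x s)
    (wt := fun x s => C - pdt u x s)
    (ContinuousOn.sub (by fun_prop) (hu.continuousOn_rect h0.le htT))
    (fun x hx => by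
      have habs : |x - x₀| ≤ ρ := abs_le.2 ⟨by linarith [hx.1], by linarith [hx.2]⟩
      have h1 := hL t₁ ⟨hτt₁, ht₁t.trans_lt htT⟩ x (habs.trans hρ1)
      have h2 : L * |x - x₀| ≤ (|L| + 1) * ρ := by
        have := abs_nonneg (x - x₀)
        have := le_abs_self L
        gcongr
        linarith
      have h3 : 0 ≤ K * (x - x₀) ^ 2 := by positivity
      simp only [sub_self, mul_zero, add_zero]
      linarith)
    (fun s hs h => absurd h (not_le.2 (by
      have h1 := hM (x₀ - ρ) s (h0.trans hs.1).le (hT1 hs)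
      have h2 := mul_nonneg hC0 (sub_nonneg.2 hs.1.le)
      rw [show (x₀ - ρ - x₀) ^ 2 = ρ ^ 2 by ring, hKρ]
      linarith)))
    (fun s hs h => absurd h (not_le.2 (by
      have h1 := hM (x₀ + ρ) s (h0.trans hs.1).le (hT1 hs)
      have h2 := mul_nonneg hC0 (sub_nonneg.2 hs.1.le)
      rw [show (x₀ + ρ - x₀) ^ 2 = ρ ^ 2 by ring, hKρ]
      linarith)))
    (fun x _ s hs => by
      have h1 : HasDerivAt (fun y => K * (y - x₀) ^ 2) (K * (2 * (x - x₀))) x := by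
        simpa using (((hasDerivAt_id x).sub_const x₀).fun_pow 2).const_mul K
      exact ((h1.const_add _).add_const _).fun_sub
        (hu.hasDerivAt_x (h0.trans hs.1) (hT1 hs)))
    (fun x _ s hs => by
      have h1 : HasDerivAt (fun y => K * (2 * (y - x₀))) (K * 2) x := by
        simpa using (((hasDerivAt_id x).sub_const x₀).const_mul 2).const_mul K
      exact h1.fun_sub (hu.hasDerivAt_xx (h0.trans hs.1) (hT1 hs)))
    (fun x _ s hs => by
      have h1 : HasDerivAt (fun s => C * (s - t₁)) C s := by
        simpa using ((hasDerivAt_id s).sub_const t₁).const_mul C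
      exact (h1.const_add _).fun_sub (hu.hasDerivAt_t (h0.trans hs.1) (hT1 hs)))
    (fun x hx s hs _ hwx hwxx => by
      have e := hu.eqn x s (h0.trans hs.1) (hT1 hs)
      have hp : pdx u x s = 2 * K * (x - x₀) := by linarith
      have habs : |x - x₀| ≤ ρ := abs_le.2 ⟨by linarith [hx.1], by linarith [hx.2]⟩
      have h1 : 0 ≤ N / u x s :=
        div_nonneg hu.nonneg (hu.pos x s (h0.trans hs.1).le (hT1 hs)).le
      have h2 : pdxx u x s / (pdx u x s ^ 2 + 1) ≤ 2 * K := by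
        rw [div_le_iff₀ (by positivity)]
        have : 0 ≤ 2 * K * pdx u x s ^ 2 := by positivity
        linarith
      have h3 : f x * √(pdx u x s ^ 2 + 1) ≤ F * √((2 * K * ρ) ^ 2 + 1) := by
        have hsq : pdx u x s ^ 2 ≤ (2 * K * ρ) ^ 2 := by
          rw [hp, mul_pow, mul_pow _ ρ, ← sq_abs (x - x₀)]
          gcongr
        have := hfF x
        gcongr
      show 0 < C - pdt u x s
      rw [e, hC]
      linarith)
    x₀ ⟨by linarith, by linarith⟩ t ⟨ht₁t, le_rfl⟩
  simp only [sub_self] at hmain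
  linarith

/-- The solution converges to a positive limit at every point of `(0, 1/2]`. -/
lemma exists_pos_limit (hu : IsFlow T N f u) (hT : 0 < T)
    (hmono : ∀ t, 0 ≤ t → t < T → MonotoneOn (fun x => u x t) (Icc 0 (1 / 2)))
    (hsym : ∀ x t, 0 ≤ t → t < T → u x t = u (1 - x) t)
    (hf' : ∀ x ∈ Icc (0 : ℝ) (1 / 2), 0 ≤ deriv f x) (h01 : u 0 0 < u (1 / 2) 0)
    {x₀ : ℝ} (hx₀ : 0 < x₀) (hx₀' : x₀ ≤ 1 / 2) :
    ∃ L, 0 < L ∧ Tendsto (fun t => u x₀ t) (𝓝[<] T) (𝓝 L) := by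
  obtain ⟨F, hF, hfF⟩ := exists_bound_of_periodic hu.diff.continuous hu.force_periodic
  obtain ⟨M, hM0, hM⟩ := hu.exists_upper_bound hT
  obtain ⟨L, ρ, τ, hρ, hτ, hτT, hL⟩ : ∃ L ρ τ, 0 < ρ ∧ 0 < τ ∧ τ < T ∧
      ∀ t ∈ Ico τ T, ∀ x, |x - x₀| ≤ ρ → u x t ≤ u x₀ t + L * |x - x₀| := by
    rcases hx₀'.eq_or_lt with rfl | hlt
    · refine ⟨0, 1 / 2, T / 2, by norm_num, by linarith, by linarith, fun t ht x hx => ?_⟩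
      have ht0 : 0 ≤ t := by linarith [ht.1]
      obtain ⟨h1, h2⟩ := abs_le.1 hx
      rw [zero_mul, add_zero]
      rcases le_total x (1 / 2) with h | h
      · exact hmono t ht0 ht.2 ⟨by linarith, h⟩ ⟨by norm_num, le_rfl⟩ h
      · rw [hsym x t ht0 ht.2]
        exact hmono t ht0 ht.2 ⟨by linarith, by linarith⟩ ⟨by norm_num, le_rfl⟩ (by linarith)
    · obtain ⟨L, ρ, τ, hρ, hτ, hτT, hL⟩ :=
        hu.exists_eventual_slope_bound hT hmono hf' h01 hx₀ hlt
      refine ⟨max L 0, min ρ x₀, τ, lt_min hρ hx₀, hτ, hτT, fun t ht x hx => ?_⟩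
      have ht0 : 0 < t := hτ.trans_le ht.1
      obtain ⟨h1, h2⟩ := abs_le.1 hx
      have h3 := min_le_left ρ x₀
      have h4 := min_le_right ρ x₀
      rcases le_total x x₀ with h | h
      · have h5 := hmono t ht0.le ht.2 ⟨by linarith, by linarith⟩ ⟨hx₀.le, hx₀'⟩ h
        have h6 : 0 ≤ max L 0 * |x - x₀| := by positivity
        dsimp only at h5
        linarith
      · have h5 := hu.le_mul_sub ht0 ht.2 h (fun z hz =>
          (hL t ht z ⟨hz.1.le, by linarith [hz.2]⟩).trans (le_max_left L 0))
        rw [abs_of_nonneg (by linarith)]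
        linarith
  obtain ⟨l, hl⟩ := exists_tendsto_of_le_add (h := fun t => u x₀ t) hτT
    (fun t ht => (hu.pos x₀ t (hτ.le.trans ht.1) ht.2).le)
    (fun t ht => hM x₀ t (hτ.le.trans ht.1) ht.2)
    (fun δ hδ => hu.exists_growth_bound hρ hτ hM0 hM hF.le hfF hL hδ)
  obtain ⟨m, τ', hm, -, hτ'T, hlow⟩ := hu.exists_eventual_lower_bound hT hmono hf' h01 hx₀ hx₀'
  exact ⟨l, hm.trans_le (ge_of_tendsto hl (by
    filter_upwards [Ico_mem_nhdsLT hτ'T] with t ht using hlow t ht)), hl⟩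

/-- Every value of a symmetric solution is attained at a point of `[0, 1/2]`, which vanishes only
for integer arguments. -/
lemma exists_mem_half_period (hu : IsFlow T N f u)
    (hsym : ∀ x t, 0 ≤ t → t < T → u x t = u (1 - x) t) (x : ℝ) :
    ∃ y ∈ Icc (0 : ℝ) (1 / 2), ((∀ m : ℤ, x ≠ m) → 0 < y) ∧
      ∀ t, 0 ≤ t → t < T → u x t = u y t := by
  have hfr : ∀ t, u x t = u (Int.fract x) t := fun t => by
    have hper : Function.Periodic (fun x => u x t) 1 := fun x => hu.periodic x t
    have := hper.sub_int_mul_eq ⌊x⌋ (x := x)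
    rw [mul_one] at this
    exact this.symm
  have hf0 := Int.fract_nonneg x
  have hf1 := Int.fract_lt_one x
  rcases le_total (Int.fract x) (1 / 2) with h | h
  · refine ⟨Int.fract x, ⟨hf0, h⟩, fun hx => hf0.lt_of_ne fun h0 => ?_, fun t _ _ => hfr t⟩
    refine hx ⌊x⌋ ?_
    have := Int.self_sub_floor x
    linarith
  · exact ⟨1 - Int.fract x, ⟨by linarith, by linarith⟩, fun _ => by linarith,
      fun t h0 h1 => by rw [hfr, hsym _ t h0 h1]⟩

end IsFlow

lemma IsSol.isFlow {n : ℕ} {f g : ℝ → ℝ} {T : ℝ} {u : ℝ → ℝ → ℝ} (hn : 1 ≤ n) (hA : A1 f g)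
    (hu : IsSol n f g 1 1 (T : EReal) u) : IsFlow T ((n : ℝ) - 1) f u where
  nonneg := by
    have : (1 : ℝ) ≤ n := by exact_mod_cast hn
    linarith
  smooth := by
    have := hu.smooth
    simp only [EReal.coe_lt_coe_iff] at this
    exact this
  pos x t h0 h1 := hu.pos x t h0 (EReal.coe_lt_coe_iff.2 h1)
  cont := by
    have := hu.cont
    simp only [EReal.coe_lt_coe_iff] at this
    exact this
  periodic := hu.periodic
  eqn x t h0 h1 := by
    have := hu.eqn x t h0 (EReal.coe_lt_coe_iff.2 h1)
    rwa [div_one, one_mul] at this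
  diff := hA.1
  force_periodic := hA.2.1
  force_pos := hA.2.2.1

/-- Theorem 1.4 of the paper: under (A1), (A2) and
`(max f)(max g) < n − 1`, if `u` is a positive classical solution on `ℝ × [0,T*)`
(equation with `ε = 1`) with quenching time `T* < ∞` (i.e. `inf_x u(x,t) > 0` for `t < T*`
and `inf_x u(x,t) → 0` as `t → T*⁻`), symmetric under `x ↦ 1 − x`, then `u(k,t) → 0` as
`t → T*⁻` for every integer `k`, while for every non-integer `x` the limit of `u(x,t)` as
`t → T*⁻` exists and is strictly positive. -/
theorem quenching_locations (n : ℕ) (hn : 2 ≤ n) (f g : ℝ → ℝ)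
    (hA1 : A1 f g) (hA2 : A2 f g)
    (hfg : sSup (Set.range f) * sSup (Set.range g) < (n : ℝ) - 1)
    (Ts : ℝ) (hTs : 0 < Ts) (u : ℝ → ℝ → ℝ)
    (hu : IsSol n f g 1 1 (Ts : EReal) u)
    (hinf : ∀ t : ℝ, 0 ≤ t → t < Ts → 0 < sInf (Set.range fun x => u x t))
    (hquench : Tendsto (fun t => sInf (Set.range fun x => u x t)) (𝓝[<] Ts) (𝓝 0))
    (hsym : ∀ x t : ℝ, 0 ≤ t → t < Ts → u x t = u (1 - x) t) :
    (∀ k : ℤ, Tendsto (fun t => u (k : ℝ) t) (𝓝[<] Ts) (𝓝 0)) ∧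
    (∀ x : ℝ, (∀ m : ℤ, x ≠ (m : ℝ)) →
      ∃ L : ℝ, 0 < L ∧ Tendsto (fun t => u x t) (𝓝[<] Ts) (𝓝 L)) := by
  have hflow := hu.isFlow (by omega) hA1
  obtain ⟨hfd, hfp, -, hgd, hgp, -⟩ := hA1
  obtain ⟨hfs, hgs, hf', hg', hg01⟩ := hA2
  have hmon : ∀ {h : ℝ → ℝ}, Differentiable ℝ h → (∀ x ∈ Icc (0 : ℝ) (1 / 2), 0 ≤ deriv h x) →
      MonotoneOn h (Icc 0 (1 / 2)) := fun hd h' =>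
    monotoneOn_of_deriv_nonneg (convex_Icc _ _) hd.continuous.continuousOn hd.differentiableOn
      (fun x hx => h' x (interior_subset hx))
  have hu0 : ∀ x, u x 0 = g x := fun x => by rw [hu.init x, Real.one_rpow, one_mul]
  have hmono : ∀ t, 0 ≤ t → t < Ts → MonotoneOn (fun x => u x t) (Icc 0 (1 / 2)) :=
    fun t h0 h1 => hflow.monotoneOn
      (fun l x hl0 hl hx => le_reflect hfp hfs (hmon (hfd.differentiable (by simp)) hf') hl0 hl hx)
      (fun l x hl0 hl hx => by
        rw [hu0, hu0]
        exact le_reflect hgp hgs (hmon (hgd.differentiable (by simp)) hg') hl0 hl hx) h0 h1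
  have hev : ∀ᶠ t in 𝓝[<] Ts, t ∈ Ico 0 Ts := Ico_mem_nhdsLT hTs
  refine ⟨fun k => hquench.congr' ?_, fun x hx => ?_⟩
  · filter_upwards [hev] with t ht
    have hk : u (k : ℝ) t = u 0 t := by
      have hper : Function.Periodic (fun x => u x t) 1 := fun x => hu.periodic x t
      simpa using hper.int_mul_eq k
    refine IsLeast.csInf_eq ⟨⟨k, rfl⟩, ?_⟩
    rintro _ ⟨x, rfl⟩
    obtain ⟨y, hy, -, hxy⟩ := hflow.exists_mem_half_period hsym x
    dsimp only
    rw [hk, hxy t ht.1 ht.2]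
    exact hmono t ht.1 ht.2 ⟨le_rfl, by norm_num⟩ hy hy.1
  · obtain ⟨y, hy, hy0, hxy⟩ := hflow.exists_mem_half_period hsym x
    obtain ⟨L, hL, hlim⟩ := hflow.exists_pos_limit hTs hmono hsym hf' (by rwa [hu0, hu0])
      (hy0 hx) hy.2
    exact ⟨L, hL, hlim.congr' (by
      filter_upwards [hev] with t ht using (hxy t ht.1 ht.2).symm)⟩
end
end

section
/- Assume (A1) and (A2). Let u be a positive classical solution on ℝ × [0,T*) such that u(x,t) = u(1−x,t) for all (x,t) (this symmetry follows from uniqueness of solutions) and such that u_x extends continuously to ℝ × [0,T*) with u_x(x,0) = g'(x). Then u_x(0,t) = u_x(1/2,t) = 0 for all t ∈ (0,T*), and u_x(x,t) > 0 for all (x,t) ∈ (0,1/2) × (0,T*). -/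
open Real Set Filter Topology

noncomputable section

/-- The second derivative is nonnegative at a local minimum. -/
lemma IsLocalMin.second_deriv_nonneg {w w' : ℝ → ℝ} {x w'' : ℝ} (hmin : IsLocalMin w x)
    (h1 : ∀ᶠ y in 𝓝 x, HasDerivAt w (w' y) y) (h2 : HasDerivAt w' w'' x) : 0 ≤ w'' := by
  by_contra! hneg
  have hd : deriv w =ᶠ[𝓝 x] w' := h1.mono fun y hy => hy.deriv
  have hdd : deriv (deriv w) x = w'' := by rw [hd.deriv_eq, h2.deriv]
  have hmax : IsLocalMax w x :=
    isLocalMax_of_deriv_deriv_neg (by rw [hdd]; exact hneg) hmin.deriv_eq_zero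
      h1.self_of_nhds.continuousAt
  have hconst : w =ᶠ[𝓝 x] fun _ => w x := by
    filter_upwards [hmin, hmax] with y h h' using le_antisymm h' h
  have hdz : deriv w =ᶠ[𝓝 x] fun _ => 0 := by
    filter_upwards [hconst.eventuallyEq_nhds] with y hy
    rw [hy.deriv_eq, deriv_const]
  rw [hdz.deriv_eq, deriv_const] at hdd
  exact hneg.ne hdd.symm

/-- If a function is minimal from the left at `t`, its derivative there is nonpositive. -/
lemma HasDerivAt.nonpos_of_eventually_left {w : ℝ → ℝ} {t w' : ℝ} (h : HasDerivAt w w' t)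
    (hmin : ∀ᶠ s in 𝓝[<] t, w t ≤ w s) : w' ≤ 0 := by
  have hs : Tendsto (slope w t) (𝓝[<] t) (𝓝 w') :=
    (hasDerivWithinAt_iff_tendsto_slope' (notMem_Iio.2 le_rfl)).1 h.hasDerivWithinAt
  refine le_of_tendsto hs ?_
  filter_upwards [hmin, self_mem_nhdsWithin] with s hs1 hs2
  rw [slope_def_field]
  exact div_nonpos_of_nonneg_of_nonpos (sub_nonneg.2 hs1) (sub_nonpos.2 (le_of_lt hs2))

/-- Parabolic minimum principle: a continuous function on a compact space-time set is nonnegative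
if no point where it is negative can satisfy the first and second order conditions of a minimum. -/
lemma parabolic_minimum_principle {K : Set (ℝ × ℝ)} (hK : IsCompact K) {W : ℝ → ℝ → ℝ}
    (hW : ContinuousOn (fun p : ℝ × ℝ => W p.1 p.2) K)
    (h : ∀ x t, (x, t) ∈ K → W x t < 0 →
      (∀ᶠ y in 𝓝 x, (y, t) ∈ K) ∧ (∀ᶠ s in 𝓝[<] t, (x, s) ∈ K) ∧
      ∃ (wt : ℝ) (wx : ℝ → ℝ) (wxx : ℝ), HasDerivAt (fun s => W x s) wt t ∧
        (∀ᶠ y in 𝓝 x, HasDerivAt (fun z => W z t) (wx y) y) ∧ HasDerivAt wx wxx x ∧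
        ¬ (wx x = 0 ∧ 0 ≤ wxx ∧ wt ≤ 0)) :
    ∀ x t, (x, t) ∈ K → 0 ≤ W x t := by
  intro x₀ t₀ h₀
  obtain ⟨⟨x, t⟩, hp, hmin⟩ := hK.exists_isMinOn ⟨_, h₀⟩ hW
  have hmin' : ∀ y s, (y, s) ∈ K → W x t ≤ W y s := fun y s hys => hmin hys
  by_contra! hneg
  obtain ⟨hx, ht, wt, wx, wxx, dt, dx, dxx, hnot⟩ :=
    h x t hp ((hmin' _ _ h₀).trans_lt hneg)
  have hlm : IsLocalMin (fun z => W z t) x := hx.mono fun y hy => hmin' _ _ hy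
  exact hnot ⟨hlm.hasDerivAt_eq_zero dx.self_of_nhds, hlm.second_deriv_nonneg dx dxx,
    dt.nonpos_of_eventually_left (ht.mono fun s hs => hmin' _ _ hs)⟩

lemma hasDerivAt_fst_slice {F : ℝ × ℝ → ℝ} {x t : ℝ} (h : DifferentiableAt ℝ F (x, t)) :
    HasDerivAt (fun y => F (y, t)) (fderiv ℝ F (x, t) (1, 0)) x :=
  h.hasFDerivAt.comp_hasDerivAt x ((hasDerivAt_id x).prodMk (hasDerivAt_const x t))

lemma hasDerivAt_snd_slice {F : ℝ × ℝ → ℝ} {x t : ℝ} (h : DifferentiableAt ℝ F (x, t)) :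
    HasDerivAt (fun s => F (x, s)) (fderiv ℝ F (x, t) (0, 1)) t :=
  h.hasFDerivAt.comp_hasDerivAt t ((hasDerivAt_const t x).prodMk (hasDerivAt_id t))

/-- The mixed partial derivatives of a `C²` function exist and agree. -/
lemma exists_mixed_deriv {u : ℝ → ℝ → ℝ} {x t : ℝ}
    (h : ContDiffAt ℝ 2 (fun p : ℝ × ℝ => u p.1 p.2) (x, t)) :
    ∃ D, HasDerivAt (fun s => pdx u x s) D t ∧ HasDerivAt (fun y => pdt u y t) D x := by
  set F : ℝ × ℝ → ℝ := fun p => u p.1 p.2 with hF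
  have hsymm : IsSymmSndFDerivAt ℝ F (x, t) := h.isSymmSndFDerivAt (by simp)
  have hdiff : ∀ᶠ p in 𝓝 (x, t), DifferentiableAt ℝ F p :=
    (h.eventually (by simp)).mono fun p hp => hp.differentiableAt (by simp)
  have hF' : DifferentiableAt ℝ (fderiv ℝ F) (x, t) :=
    (h.fderiv_right (m := 1) (by norm_num)).differentiableAt (by simp)
  have happ : ∀ e : ℝ × ℝ, HasFDerivAt (fun p => fderiv ℝ F p e)
      ((ContinuousLinearMap.apply ℝ ℝ e).comp (fderiv ℝ (fderiv ℝ F) (x, t))) (x, t) := fun e =>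
    (ContinuousLinearMap.apply ℝ ℝ e).hasFDerivAt.comp (x, t) hF'.hasFDerivAt
  have ct : Tendsto (fun s => (x, s)) (𝓝 t) (𝓝 (x, t)) :=
    (Continuous.prodMk_right x).tendsto t
  have cx : Tendsto (fun y => (y, t)) (𝓝 x) (𝓝 (x, t)) :=
    (Continuous.prodMk_left t).tendsto x
  refine ⟨fderiv ℝ (fderiv ℝ F) (x, t) (0, 1) (1, 0), ?_, ?_⟩
  · have h1 := hasDerivAt_snd_slice (happ (1, 0)).differentiableAt
    rw [(happ (1, 0)).fderiv] at h1
    refine h1.congr_of_eventuallyEq ?_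
    filter_upwards [ct.eventually hdiff] with s hs
    exact (hasDerivAt_fst_slice hs).deriv
  · have h1 := hasDerivAt_fst_slice (happ (0, 1)).differentiableAt
    rw [(happ (0, 1)).fderiv] at h1
    rw [hsymm.eq]
    refine h1.congr_of_eventuallyEq ?_
    filter_upwards [cx.eventually hdiff] with y hy
    exact (hasDerivAt_snd_slice hy).deriv

/-- The equation satisfied by `u_x` at positive times. -/
lemma IsSol.hasDerivAt_pdx {n : ℕ} {f g : ℝ → ℝ} {Ts : ℝ} {u : ℝ → ℝ → ℝ}
    (hu : IsSol n f g 1 1 (Ts : EReal) u) (hf : ContDiff ℝ 1 f) {t : ℝ} (ht : 0 < t)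
    (htT : t < Ts) (x : ℝ) :
    HasDerivAt (fun y => pdx u y t) (pdxx u x t) x ∧
    ∃ vt vxx, HasDerivAt (fun s => pdx u x s) vt t ∧ HasDerivAt (fun y => pdxx u y t) vxx x ∧
      vt = vxx / (pdx u x t ^ 2 + 1)
        - 2 * pdx u x t * pdxx u x t ^ 2 / (pdx u x t ^ 2 + 1) ^ 2
        + ((n : ℝ) - 1) * pdx u x t / u x t ^ 2
        + deriv f x * √(pdx u x t ^ 2 + 1)
        + f x * (pdx u x t * pdxx u x t / √(pdx u x t ^ 2 + 1)) := by
  have htT' : (t : EReal) < (Ts : EReal) := by exact_mod_cast htT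
  have hopen : IsOpen {p : ℝ × ℝ | 0 < p.2 ∧ (p.2 : EReal) < (Ts : EReal)} := by
    simp only [EReal.coe_lt_coe_iff]
    exact (isOpen_lt continuous_const continuous_snd).inter
      (isOpen_lt continuous_snd continuous_const)
  have hC : ∀ y, ContDiffAt ℝ (⊤ : ℕ∞) (fun p : ℝ × ℝ => u p.1 p.2) (y, t) := fun y =>
    hu.smooth.contDiffAt (hopen.mem_nhds ⟨ht, htT'⟩)
  have hslice : ContDiff ℝ 3 (fun y => u y t) := by
    rw [contDiff_iff_contDiffAt]
    intro y
    have h1 : ContDiffAt ℝ 3 (fun p : ℝ × ℝ => u p.1 p.2) (y, t) :=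
      contDiffAt_infty.1 (hC y) 3
    exact h1.comp y (contDiffAt_id.prodMk contDiffAt_const)
  have hv : ContDiff ℝ 2 (fun y => pdx u y t) :=
    ((contDiff_succ_iff_deriv (n := 2)).1 (by norm_num; exact hslice)).2.2
  have hp : ContDiff ℝ 1 (fun y => pdxx u y t) :=
    ((contDiff_succ_iff_deriv (n := 1)).1 (by norm_num; exact hv)).2.2
  have dU : HasDerivAt (fun y => u y t) (pdx u x t) x :=
    (hslice.differentiable (by simp) x).hasDerivAt
  have dV : HasDerivAt (fun y => pdx u y t) (pdxx u x t) x :=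
    (hv.differentiable (by simp) x).hasDerivAt
  have dP : HasDerivAt (fun y => pdxx u y t) (deriv (fun y => pdxx u y t) x) x :=
    (hp.differentiable (by simp) x).hasDerivAt
  have dF : HasDerivAt f (deriv f x) x := (hf.differentiable (by simp) x).hasDerivAt
  obtain ⟨D, hD1, hD2⟩ := exists_mixed_deriv (contDiffAt_infty.1 (hC x) 2)
  refine ⟨dV, D, _, hD1, dP, ?_⟩
  have hu0 : u x t ≠ 0 := (hu.pos x t ht.le htT').ne'
  have hq : 0 < pdx u x t ^ 2 + 1 := by positivity
  have dQ := (dV.pow 2).add_const 1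
  have dR := ((dP.div dQ hq.ne').sub ((hasDerivAt_const x ((n : ℝ) - 1)).div dU hu0)).add
    (dF.mul (dQ.sqrt hq.ne'))
  have heq : (fun y => pdt u y t) = fun y =>
      pdxx u y t / (pdx u y t ^ 2 + 1) - ((n : ℝ) - 1) / u y t
        + f y * √(pdx u y t ^ 2 + 1) := by
    funext y
    rw [hu.eqn y t ht htT']
    norm_num
  rw [heq] at hD2
  rw [hD2.unique dR]
  have hs : √(pdx u x t ^ 2 + 1) ≠ 0 := (Real.sqrt_pos.2 hq).ne'
  simp
  field_simp
  ring

/-- The reflection symmetries force `u_x` to vanish at `0` and `1/2`. -/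
lemma pdx_eq_zero_of_symmetric {u : ℝ → ℝ → ℝ} {t : ℝ} (hper : ∀ x, u (x + 1) t = u x t)
    (hsym : ∀ x, u x t = u (1 - x) t) : pdx u 0 t = 0 ∧ pdx u (1 / 2) t = 0 := by
  have h1 : ∀ x, pdx u x t = -pdx u (1 - x) t := fun x => by
    have := deriv_comp_const_sub (f := fun y => u y t) (a := 1) (x := x)
    simp only [← hsym] at this
    exact this
  have h2 : pdx u 0 t = pdx u (0 + 1) t := by
    have := deriv_comp_add_const (f := fun y => u y t) (a := 1) (x := 0)
    simp only [hper] at this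
    exact this
  have h3 := h1 0
  have h4 := h1 (1 / 2)
  norm_num at h2 h3 h4
  norm_num
  constructor <;> linarith

/-- `u_x` is nonnegative on the half period. -/
lemma pdx_nonneg {n : ℕ} {f g : ℝ → ℝ} (hf : ContDiff ℝ 1 f)
    (hf' : ∀ x ∈ Set.Icc (0 : ℝ) (1 / 2), 0 ≤ deriv f x)
    (hg' : ∀ x ∈ Set.Icc (0 : ℝ) (1 / 2), 0 ≤ deriv g x)
    {Ts : ℝ} {u : ℝ → ℝ → ℝ} (hu : IsSol n f g 1 1 (Ts : EReal) u)
    (hbd : ∀ t, 0 ≤ t → t < Ts → pdx u 0 t = 0 ∧ pdx u (1 / 2) t = 0)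
    (huxcont : ContinuousOn (fun p : ℝ × ℝ => pdx u p.1 p.2) {p : ℝ × ℝ | 0 ≤ p.2 ∧ p.2 < Ts})
    (huxinit : ∀ x : ℝ, pdx u x 0 = deriv g x) {x₁ t₁ : ℝ}
    (hx₁ : x₁ ∈ Set.Icc (0 : ℝ) (1 / 2)) (ht₀ : 0 ≤ t₁) (ht₁ : t₁ < Ts) : 0 ≤ pdx u x₁ t₁ := by
  set K : Set (ℝ × ℝ) := Set.Icc (0 : ℝ) (1 / 2) ×ˢ Set.Icc (0 : ℝ) t₁ with hKdef
  have hK : IsCompact K := isCompact_Icc.prod isCompact_Icc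
  have hpos : ∀ x t, (x, t) ∈ K → 0 < u x t := fun x t h =>
    hu.pos x t h.2.1 (by exact_mod_cast h.2.2.trans_lt ht₁)
  have hucont : ContinuousOn (fun p : ℝ × ℝ => u p.1 p.2) K := hu.cont.mono fun p h =>
    ⟨h.2.1, by exact_mod_cast h.2.2.trans_lt ht₁⟩
  obtain ⟨C, hC⟩ := hK.exists_bound_of_continuousOn
    (f := fun p : ℝ × ℝ => ((n : ℝ) - 1) / u p.1 p.2 ^ 2)
    (continuousOn_const.div (hucont.pow 2) fun p h => (pow_pos (hpos p.1 p.2 h) 2).ne')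
  have hvcont : ContinuousOn (fun p : ℝ × ℝ => pdx u p.1 p.2) K := huxcont.mono fun p h =>
    ⟨h.2.1, h.2.2.trans_lt ht₁⟩
  have key := parabolic_minimum_principle hK
    (W := fun x t => Real.exp (-(C + 1) * t) * pdx u x t)
    (ContinuousOn.mul (by fun_prop) hvcont) ?_ x₁ t₁ ⟨hx₁, ht₀, le_rfl⟩
  · exact nonneg_of_mul_nonneg_right key (Real.exp_pos _)
  intro x t hxt hneg
  have hvneg : pdx u x t < 0 := by
    by_contra! h
    exact hneg.not_ge (mul_nonneg (Real.exp_pos _).le h)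
  have hcx := hC _ hxt
  obtain ⟨⟨hx0, hx1⟩, ht0, ht1⟩ := hxt
  simp only at hx0 hx1 ht0 ht1 hcx
  have htT := ht1.trans_lt ht₁
  have ht0' : 0 < t := ht0.lt_of_ne fun h => by
    rw [← h, huxinit] at hvneg
    exact hvneg.not_ge (hg' x ⟨hx0, hx1⟩)
  have hx0' : 0 < x := hx0.lt_of_ne fun h => by
    rw [← h, (hbd t ht0 htT).1] at hvneg
    exact lt_irrefl _ hvneg
  have hx1' : x < 1 / 2 := hx1.lt_of_ne fun h => by
    rw [h, (hbd t ht0 htT).2] at hvneg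
    exact lt_irrefl _ hvneg
  refine ⟨?_, ?_, ?_⟩
  · filter_upwards [Icc_mem_nhds hx0' hx1'] with y hy using ⟨hy, ht0, ht1⟩
  · filter_upwards [Ioo_mem_nhdsLT ht0'] with s hs
    exact ⟨⟨hx0, hx1⟩, hs.1.le, hs.2.le.trans ht1⟩
  obtain ⟨-, vt, vxx, dt, dxx, heq⟩ := hu.hasDerivAt_pdx hf ht0' htT x
  have dE : HasDerivAt (fun s => Real.exp (-(C + 1) * s))
      (Real.exp (-(C + 1) * t) * (-(C + 1) * 1)) t :=
    ((hasDerivAt_id t).const_mul (-(C + 1))).exp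
  refine ⟨_, fun y => Real.exp (-(C + 1) * t) * pdxx u y t, _, dE.mul dt,
    Eventually.of_forall fun y => (hu.hasDerivAt_pdx hf ht0' htT y).1.const_mul _,
    dxx.const_mul _, ?_⟩
  rintro ⟨h1, h2, h3⟩
  set E := Real.exp (-(C + 1) * t) with hE
  have hE0 : 0 < E := Real.exp_pos _
  have hp0 : pdxx u x t = 0 := (mul_eq_zero.1 h1).resolve_left hE0.ne'
  have hvxx : 0 ≤ vxx := nonneg_of_mul_nonneg_right h2 hE0
  have hvt : vt - (C + 1) * pdx u x t ≤ 0 := by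
    by_contra! h
    nlinarith [mul_pos hE0 h]
  rw [hp0] at heq
  have hc : ((n : ℝ) - 1) / u x t ^ 2 ≤ C := (le_abs_self _).trans hcx
  have t1 : 0 ≤ vxx / (pdx u x t ^ 2 + 1) := by positivity
  have t2 : 0 ≤ deriv f x * √(pdx u x t ^ 2 + 1) :=
    mul_nonneg (hf' x ⟨hx0, hx1⟩) (Real.sqrt_nonneg _)
  have t3 : ((n : ℝ) - 1) * pdx u x t / u x t ^ 2 = ((n : ℝ) - 1) / u x t ^ 2 * pdx u x t := by
    ring
  rw [t3] at heq
  norm_num at heq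
  nlinarith [mul_nonneg (sub_nonneg.2 hc) (neg_nonneg.2 hvneg.le)]

/-- A quadratic with negative discriminant takes no nonpositive values. -/
lemma no_root_of_large_decay {r V C M s : ℝ} (hr : 0 < r) (hC : 0 < C)
    (hM : M = C ^ 2 * (V ^ 2 + 1) / r ^ 2)
    (h : 8 * (r ^ 2 / (V ^ 2 + 1)) - C * s + M * s ^ 2 ≤ 0) : False := by
  obtain ⟨A, hA⟩ : ∃ A, A = r ^ 2 / (V ^ 2 + 1) := ⟨_, rfl⟩
  have hA0 : 0 < A := by rw [hA]; positivity
  have hM' : M * A = C ^ 2 := by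
    rw [hM, hA]
    field_simp
  rw [← hA] at h
  have h7 : 8 * A ^ 2 - C * s * A + (C * s) ^ 2 ≤ 0 := by
    have : A * (8 * A - C * s + M * s ^ 2) = 8 * A ^ 2 - C * s * A + (C * s) ^ 2 := by
      linear_combination s ^ 2 * hM'
    rw [← this]
    exact mul_nonpos_of_nonneg_of_nonpos hA0.le h
  nlinarith [sq_nonneg (C * s - A / 2), pow_pos hA0 2]

/-- The bump `G s²`, `s = r² - y²`, moving with speed `k` and decaying at rate `M`, is a strict
subsolution of the equation for `u_x` when `M` is large: it cannot touch a solution from below. -/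
lemma no_touching_of_moving_bump {v p vt vxx f F V r y s k G M : ℝ} (hv0 : 0 ≤ v) (hvV : v ≤ V)
    (hf0 : 0 ≤ f) (hfF : f ≤ F) (hr0 : 0 < r) (hr1 : r ≤ 1) (hs : s = r ^ 2 - y ^ 2)
    (hs0 : 0 < s) (hG0 : 0 < G) (hG1 : G ≤ 1) (hp : p = -4 * G * s * y)
    (hvxx : G * (8 * y ^ 2 - 4 * s) ≤ vxx) (hvt : vt ≤ G * (-M * s ^ 2 + 4 * s * y * k))
    (hM : M = (28 + 4 * F + 4 * |k|) ^ 2 * (V ^ 2 + 1) / r ^ 2)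
    (heq : vxx / (v ^ 2 + 1) - 2 * v * p ^ 2 / (v ^ 2 + 1) ^ 2 + f * (v * p / √(v ^ 2 + 1)) ≤ vt) :
    False := by
  have hy1 : |y| ≤ 1 := by
    rw [← sq_le_one_iff_abs_le_one]
    nlinarith
  have hs1 : s ≤ 1 := by nlinarith [sq_nonneg y]
  have hq : 1 ≤ v ^ 2 + 1 := by nlinarith
  have hq0 : 0 < v ^ 2 + 1 := by positivity
  have hF0 : 0 ≤ F := hf0.trans hfF
  have hGs : 0 < G * s := mul_pos hG0 hs0
  have hp1 : |p| ≤ 4 * (G * s) := by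
    rw [hp, show -4 * G * s * y = -(4 * (G * s)) * y by ring, abs_mul, abs_neg,
      abs_of_pos (by positivity)]
    nlinarith [abs_nonneg y]
  have hGs1 : G * s ≤ 1 := by nlinarith
  have hpsq : p ^ 2 ≤ 16 * (G * s) := by
    rw [← sq_abs]
    nlinarith [abs_nonneg p]
  have e1 : 2 * v * p ^ 2 / (v ^ 2 + 1) ^ 2 ≤ 16 * (G * s) := by
    rw [div_le_iff₀ (by positivity)]
    have h1 : 2 * v ≤ (v ^ 2 + 1) ^ 2 := by nlinarith [sq_nonneg (v - 1)]
    calc 2 * v * p ^ 2 ≤ (v ^ 2 + 1) ^ 2 * (16 * (G * s)) :=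
          mul_le_mul h1 hpsq (sq_nonneg p) (by positivity)
      _ = _ := by ring
  have e2 : -(F * (4 * (G * s))) ≤ f * (v * p / √(v ^ 2 + 1)) := by
    have hsq : 0 < √(v ^ 2 + 1) := Real.sqrt_pos.2 hq0
    have hvs : v / √(v ^ 2 + 1) ≤ 1 := by
      rw [div_le_one hsq]
      exact Real.le_sqrt_of_sq_le (by linarith)
    have hvs0 : 0 ≤ v / √(v ^ 2 + 1) := by positivity
    have : |f * (v * p / √(v ^ 2 + 1))| ≤ F * (4 * (G * s)) := by
      rw [show f * (v * p / √(v ^ 2 + 1)) = f * (v / √(v ^ 2 + 1)) * p by ring, abs_mul,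
        abs_of_nonneg (mul_nonneg hf0 hvs0)]
      refine mul_le_mul ?_ hp1 (abs_nonneg p) hF0
      nlinarith
    exact neg_le_of_abs_le this
  have e3 : G * (8 * r ^ 2 / (V ^ 2 + 1) - 12 * s) ≤ vxx / (v ^ 2 + 1) := by
    have h1 : G * (8 * y ^ 2 - 4 * s) / (v ^ 2 + 1) ≤ vxx / (v ^ 2 + 1) := by gcongr
    have h2 : 8 * r ^ 2 / (V ^ 2 + 1) ≤ 8 * r ^ 2 / (v ^ 2 + 1) := by gcongr
    have h3 : 12 * s / (v ^ 2 + 1) ≤ 12 * s := div_le_self (by positivity) hq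
    have h4 : G * (8 * y ^ 2 - 4 * s) / (v ^ 2 + 1)
        = G * (8 * r ^ 2 / (v ^ 2 + 1) - 12 * s / (v ^ 2 + 1)) := by
      rw [show y ^ 2 = r ^ 2 - s by linarith]
      ring
    rw [h4] at h1
    refine le_trans ?_ h1
    gcongr
  have e4 : y * k ≤ |k| := by
    refine (le_abs_self _).trans ?_
    rw [abs_mul]
    nlinarith [abs_nonneg k]
  refine no_root_of_large_decay (r := r) (V := V) hr0 (by positivity : 0 < 28 + 4 * F + 4 * |k|)
    hM (s := s) ?_
  by_contra! h
  have h8 := mul_pos hG0 h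
  have h9 : G * s * (y * k) ≤ G * s * |k| := mul_le_mul_of_nonneg_left e4 hGs.le
  rw [mul_div_assoc] at e3
  have h10 : G * (8 * (r ^ 2 / (V ^ 2 + 1)) - (28 + 4 * F + 4 * |k|) * s + M * s ^ 2)
      = G * (8 * (r ^ 2 / (V ^ 2 + 1)) - 12 * s) - 16 * (G * s)
        - F * (4 * (G * s)) - 4 * (G * s * |k|) + G * M * s ^ 2 := by
    ring
  have h11 : G * (-M * s ^ 2 + 4 * s * y * k) = 4 * (G * s * (y * k)) - G * M * s ^ 2 := by
    ring
  rw [h10] at h8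
  rw [h11] at hvt
  linarith only [h8, h9, hvt, e1, e2, e3, heq]

set_option maxHeartbeats 400000 in
/-- Positivity of `u_x` at one interior point initially spreads to all of `(0,1/2)`. -/
lemma pdx_pos {n : ℕ} (hn : 1 ≤ n) {f : ℝ → ℝ} (hf : ContDiff ℝ 1 f) (hf0 : ∀ x, 0 < f x)
    (hf' : ∀ x ∈ Set.Icc (0 : ℝ) (1 / 2), 0 ≤ deriv f x)
    {g : ℝ → ℝ} {Ts : ℝ} {u : ℝ → ℝ → ℝ} (hu : IsSol n f g 1 1 (Ts : EReal) u)
    (huxcont : ContinuousOn (fun p : ℝ × ℝ => pdx u p.1 p.2) {p : ℝ × ℝ | 0 ≤ p.2 ∧ p.2 < Ts})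
    (hnn : ∀ x t, x ∈ Set.Icc (0 : ℝ) (1 / 2) → 0 ≤ t → t < Ts → 0 ≤ pdx u x t)
    {x₁ : ℝ} (hx₁ : x₁ ∈ Set.Ioo (0 : ℝ) (1 / 2)) (hpos : 0 < pdx u x₁ 0)
    {x₂ t₂ : ℝ} (hx₂ : x₂ ∈ Set.Ioo (0 : ℝ) (1 / 2)) (ht₂ : 0 < t₂) (htT : t₂ < Ts) :
    0 < pdx u x₂ t₂ := by
  have hinit : Continuous fun x => pdx u x 0 := by
    rw [← continuousOn_univ]
    exact huxcont.comp (f := fun x : ℝ => (x, (0 : ℝ))) (by fun_prop)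
      fun x _ => ⟨le_rfl, ht₂.trans htT⟩
  obtain ⟨r₀, hr₀, hball⟩ := Metric.eventually_nhds_iff.1
    (hinit.continuousAt.eventually (lt_mem_nhds (half_lt_self hpos)))
  obtain ⟨r, hr, hr1, hrr₀, hrx₁, hrx₁', hrx₂, hrx₂'⟩ : ∃ r, 0 < r ∧ r ≤ 1 ∧ r < r₀ ∧ r ≤ x₁ ∧
      r ≤ 1 / 2 - x₁ ∧ r ≤ x₂ ∧ r ≤ 1 / 2 - x₂ := by
    have h : ∀ a : ℝ, 0 < a → ∀ᶠ r in 𝓝[>] (0 : ℝ), r < a := fun a ha =>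
      mem_nhdsWithin_of_mem_nhds (gt_mem_nhds ha)
    have h0 : ∀ᶠ r in 𝓝[>] (0 : ℝ), 0 < r := self_mem_nhdsWithin
    obtain ⟨r, h0, h1, h2, h3, h4, h5, h6⟩ := (h0.and ((h 1 one_pos).and ((h r₀ hr₀).and
      ((h x₁ hx₁.1).and ((h (1 / 2 - x₁) (sub_pos.2 hx₁.2)).and
        ((h x₂ hx₂.1).and (h (1 / 2 - x₂) (sub_pos.2 hx₂.2)))))))).exists
    exact ⟨r, h0, h1.le, h2, h3.le, h4.le, h5.le, h6.le⟩
  set R : Set (ℝ × ℝ) := Set.Icc (0 : ℝ) (1 / 2) ×ˢ Set.Icc (0 : ℝ) t₂ with hRdef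
  have hR : IsCompact R := isCompact_Icc.prod isCompact_Icc
  have hvR : ContinuousOn (fun p : ℝ × ℝ => pdx u p.1 p.2) R := huxcont.mono fun p h =>
    ⟨h.2.1, h.2.2.trans_lt htT⟩
  obtain ⟨V, hV⟩ := hR.exists_bound_of_continuousOn hvR
  obtain ⟨F, hF⟩ := (isCompact_Icc (a := (0 : ℝ)) (b := 1 / 2)).exists_bound_of_continuousOn
    hf.continuous.continuousOn
  set k : ℝ := (x₂ - x₁) / t₂ with hk
  have hkt : k * t₂ = x₂ - x₁ := by rw [hk]; field_simp
  set M : ℝ := (28 + 4 * F + 4 * |k|) ^ 2 * (V ^ 2 + 1) / r ^ 2 with hM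
  have hM0 : 0 ≤ M := by positivity
  clear_value k M
  set ε : ℝ := min 1 (pdx u x₁ 0 / 2)
  have hε0 : 0 < ε := lt_min one_pos (half_pos hpos)
  have hε1 : ε ≤ 1 := min_le_left _ _
  have hε2 : ε ≤ pdx u x₁ 0 / 2 := min_le_right _ _
  clear_value ε
  set K : Set (ℝ × ℝ) := {p | p ∈ R ∧ (p.1 - (x₁ + k * p.2)) ^ 2 ≤ r ^ 2} with hKdef
  have hK : IsCompact K := hR.inter_right
    (isClosed_le (f := fun p : ℝ × ℝ => (p.1 - (x₁ + k * p.2)) ^ 2) (by fun_prop)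
      continuous_const)
  have hcenter : ∀ t, 0 ≤ t → t ≤ t₂ → r ≤ x₁ + k * t ∧ x₁ + k * t ≤ 1 / 2 - r := by
    intro t h0 h1
    have hθ0 : 0 ≤ t / t₂ := by positivity
    have hθ1 : t / t₂ ≤ 1 := (div_le_one ht₂).2 h1
    have : x₁ + k * t = (1 - t / t₂) * x₁ + t / t₂ * x₂ := by rw [hk]; field_simp; ring
    rw [this]
    constructor <;> nlinarith
  have hmemK : ∀ x t, 0 ≤ t → t ≤ t₂ → (x - (x₁ + k * t)) ^ 2 ≤ r ^ 2 → (x, t) ∈ K := by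
    intro x t h0 h1 h2
    have := abs_le.1 (abs_le_of_sq_le_sq h2 hr.le)
    have hc := hcenter t h0 h1
    exact ⟨⟨⟨by linarith, by linarith⟩, h0, h1⟩, h2⟩
  have key := parabolic_minimum_principle hK
    (W := fun x t => pdx u x t
      - ε * (Real.exp (-M * t) * (r ^ 2 - (x - (x₁ + k * t)) ^ 2) ^ 2))
    ((hvR.mono fun p hp => hp.1).sub (by fun_prop)) ?_ x₂ t₂
    (hmemK _ _ ht₂.le le_rfl (by rw [hkt]; ring_nf; positivity))
  · have hz : x₂ - (x₁ + k * t₂) = 0 := by rw [hkt]; ring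
    simp only [hz] at key
    have : 0 < ε * (Real.exp (-M * t₂) * (r ^ 2 - 0 ^ 2) ^ 2) := by
      norm_num
      positivity
    linarith
  intro x t hxt hneg
  obtain ⟨hxtR, hyr⟩ := hxt
  have hV' := (le_abs_self _).trans (hV _ hxtR)
  obtain ⟨⟨hx0, hx1⟩, ht0, ht1⟩ := hxtR
  simp only at hx0 hx1 ht0 ht1 hyr hneg hV'
  have hv0 : 0 ≤ pdx u x t := hnn x t ⟨hx0, hx1⟩ ht0 (ht1.trans_lt htT)
  have hE0 : 0 < Real.exp (-M * t) := Real.exp_pos _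
  have hE1 : Real.exp (-M * t) ≤ 1 := Real.exp_le_one_iff.2 (by nlinarith)
  have hsr : (x - (x₁ + k * t)) ^ 2 < r ^ 2 := hyr.lt_of_ne fun h => by
    rw [h] at hneg
    norm_num at hneg
    linarith
  have hs0 : 0 < r ^ 2 - (x - (x₁ + k * t)) ^ 2 := sub_pos.2 hsr
  have ht0' : 0 < t := ht0.lt_of_ne fun h => by
    subst h
    have hd : dist x x₁ < r₀ := by
      rw [Real.dist_eq]
      have hyr' : (x - x₁) ^ 2 ≤ r ^ 2 := by simpa using hyr
      exact (abs_le_of_sq_le_sq hyr' hr.le).trans_lt hrr₀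
    have h1 := hball hd
    have h3 : r ^ 2 - (x - (x₁ + k * 0)) ^ 2 ≤ 1 := by
      nlinarith [sq_nonneg (x - (x₁ + k * 0))]
    have h4 : (r ^ 2 - (x - (x₁ + k * 0)) ^ 2) ^ 2 ≤ 1 := pow_le_one₀ hs0.le h3
    have h5 := mul_le_one₀ hE1 (sq_nonneg _) h4
    nlinarith
  refine ⟨?_, ?_, ?_⟩
  · have : ∀ᶠ y in 𝓝 x, (y - (x₁ + k * t)) ^ 2 < r ^ 2 :=
      ContinuousAt.eventually_lt (by fun_prop) continuousAt_const hsr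
    exact this.mono fun y hy => hmemK _ _ ht0 ht1 hy.le
  · have : ∀ᶠ s in 𝓝 t, (x - (x₁ + k * s)) ^ 2 < r ^ 2 :=
      ContinuousAt.eventually_lt (by fun_prop) continuousAt_const hsr
    filter_upwards [mem_nhdsWithin_of_mem_nhds this, Ioo_mem_nhdsLT ht0'] with s hs hs'
    exact hmemK _ _ hs'.1.le (hs'.2.le.trans ht1) hs.le
  have htT' := ht1.trans_lt htT
  obtain ⟨-, vt, vxx, dt, dxx, heq⟩ := hu.hasDerivAt_pdx hf ht0' htT' x
  have dξ : HasDerivAt (fun s => x - (x₁ + k * s)) (-(k * 1)) t :=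
    (((hasDerivAt_id t).const_mul k).const_add x₁).const_sub x
  have dE : HasDerivAt (fun s => Real.exp (-M * s)) (Real.exp (-M * t) * (-M * 1)) t :=
    ((hasDerivAt_id t).const_mul (-M)).exp
  have dy : ∀ z, HasDerivAt (fun z => z - (x₁ + k * t)) 1 z := fun z =>
    (hasDerivAt_id z).sub_const _
  refine ⟨_, fun z => pdxx u z t - ε * (Real.exp (-M * t) *
      (-4 * ((r ^ 2 - (z - (x₁ + k * t)) ^ 2) * (z - (x₁ + k * t))))), _,
    dt.sub ((dE.mul (((dξ.pow 2).const_sub (r ^ 2)).pow 2)).const_mul ε),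
    Eventually.of_forall fun z => ?_,
    dxx.sub (((((((dy x).pow 2).const_sub (r ^ 2)).mul (dy x)).const_mul (-4)).const_mul
      (Real.exp (-M * t))).const_mul ε), ?_⟩
  · refine ((hu.hasDerivAt_pdx hf ht0' htT' z).1.sub
      (((((dy z).pow 2).const_sub (r ^ 2)).pow 2).const_mul
        (Real.exp (-M * t)) |>.const_mul ε)).congr_deriv ?_
    simp
    left
    ring
  rintro ⟨h1, h2, h3⟩
  simp only [Nat.cast_ofNat, Nat.add_one_sub_one, Pi.pow_apply, pow_one] at h1 h2 h3
  generalize Real.exp (-M * t) = E at h1 h2 h3 hE0 hE1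
  generalize x - (x₁ + k * t) = y at h1 h2 h3 hs0
  refine no_touching_of_moving_bump (G := ε * E) (k := k) (vt := vt) (vxx := vxx)
    (p := pdxx u x t) hv0 hV' (hf0 x).le ((le_abs_self _).trans (hF x ⟨hx0, hx1⟩)) hr hr1 rfl hs0
    (mul_pos hε0 hE0) (mul_le_one₀ hε1 hE0.le hE1) ?_ ?_ ?_ hM ?_
  · linear_combination h1
  · linear_combination h2
  · linear_combination h3
  have hn' : (0 : ℝ) ≤ (n : ℝ) - 1 := sub_nonneg.2 (by exact_mod_cast hn)
  have t1 : 0 ≤ ((n : ℝ) - 1) * pdx u x t / u x t ^ 2 := by positivity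
  have t2 : 0 ≤ deriv f x * √(pdx u x t ^ 2 + 1) :=
    mul_nonneg (hf' x ⟨hx0, hx1⟩) (Real.sqrt_nonneg _)
  linarith

/-- Lemma 4.1: under (A1), (A2), if `u` is a positive classical solution
on `ℝ × [0,T*)` (equation with `ε = 1`) that is symmetric under `x ↦ 1 − x`, and `u_x`
extends continuously to `ℝ × [0,T*)` with `u_x(x,0) = g'(x)`, then
`u_x(0,t) = u_x(1/2,t) = 0` for `t ∈ (0,T*)` and `u_x > 0` on `(0,1/2) × (0,T*)`. -/
theorem spatial_monotonicity (n : ℕ) (hn : 2 ≤ n) (f g : ℝ → ℝ)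
    (hA1 : A1 f g) (hA2 : A2 f g)
    (Ts : ℝ) (hTs : 0 < Ts) (u : ℝ → ℝ → ℝ)
    (hu : IsSol n f g 1 1 (Ts : EReal) u)
    (hsym : ∀ x t : ℝ, 0 ≤ t → t < Ts → u x t = u (1 - x) t)
    (huxcont : ContinuousOn (fun p : ℝ × ℝ => pdx u p.1 p.2)
      {p : ℝ × ℝ | 0 ≤ p.2 ∧ p.2 < Ts})
    (huxinit : ∀ x : ℝ, pdx u x 0 = deriv g x) :
    (∀ t : ℝ, 0 < t → t < Ts → pdx u 0 t = 0 ∧ pdx u (1 / 2) t = 0) ∧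
    (∀ x t : ℝ, 0 < x → x < 1 / 2 → 0 < t → t < Ts → 0 < pdx u x t) := by
  obtain ⟨hfC, -, hf0, hgC, -, -⟩ := hA1
  obtain ⟨-, -, hf', hg', hg⟩ := hA2
  have hbd : ∀ t, 0 ≤ t → t < Ts → pdx u 0 t = 0 ∧ pdx u (1 / 2) t = 0 := fun t h0 h1 =>
    pdx_eq_zero_of_symmetric (fun x => hu.periodic x t) fun x => hsym x t h0 h1
  refine ⟨fun t h0 h1 => hbd t h0.le h1, fun x t hx0 hx1 ht0 ht1 => ?_⟩
  obtain ⟨x₁, hx₁, hslope⟩ := exists_deriv_eq_slope g (show (0 : ℝ) < 1 / 2 by norm_num)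
    hgC.continuous.continuousOn (hgC.differentiable (by simp)).differentiableOn
  refine pdx_pos (by omega) hfC hf0 hf' hu huxcont
    (fun y s hy hs0 hs1 => pdx_nonneg hfC hf' hg' hu hbd huxcont huxinit hy hs0 hs1) hx₁ ?_
    ⟨hx0, hx1⟩ ht0 ht1
  rw [huxinit, hslope]
  exact div_pos (sub_pos.2 hg) (by norm_num)
end
end

section
/- Let f : ℝ → ℝ be continuous, ℤ-periodic and everywhere positive, let c₀ > 0, and let a, b ∈ [0,1/2] with a < b. Then there exists M > 0 such that the function w(x,t) := c₀ e^{−Mt} sin(π(x−a)/(b−a)) satisfies, for every x ∈ [a,b], every t ≥ 0, and every p ∈ ℝ, the inequality w_t(x,t) ≤ w_xx(x,t)/(p² + 1) + f(x) w(x,t) w_x(x,t)/√(p² + 1) − 2 w(x,t) (w_x(x,t))²/(p² + 1)²; in particular w is a subsolution of the differentiated equation for v = u_x with w(a,t) = w(b,t) = 0 for all t ≥ 0. -/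
open Real Set Filter Topology

noncomputable section

theorem hasDerivAt_sin_affine (A c d x : ℝ) :
    HasDerivAt (fun y => A * Real.sin (π * (y - c) / d))
      (A * (π / d) * Real.cos (π * (x - c) / d)) x := by
  have h : HasDerivAt (fun y : ℝ => π * (y - c) / d) (π / d) x := by
    simpa using (((hasDerivAt_id x).sub_const c).const_mul π).div_const d
  refine (h.sin.const_mul A).congr_deriv ?_
  ring

theorem hasDerivAt_cos_affine (A c d x : ℝ) :
    HasDerivAt (fun y => A * Real.cos (π * (y - c) / d))
      (-(A * (π / d) * Real.sin (π * (x - c) / d))) x := by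
  have h : HasDerivAt (fun y : ℝ => π * (y - c) / d) (π / d) x := by
    simpa using (((hasDerivAt_id x).sub_const c).const_mul π).div_const d
  refine (h.cos.const_mul A).congr_deriv ?_
  ring

/-- The rate bound behind the subsolution property, with `q` in the role of `p ^ 2 + 1`. -/
theorem rate_bound {k A c₀ C F φ q : ℝ} (hk : 0 ≤ k) (hA : 0 ≤ A) (hAc : A ≤ c₀)
    (hC : |C| ≤ 1) (hφ : 0 ≤ φ) (hφF : φ ≤ F) (hq : 1 ≤ q) :
    k ^ 2 / q - φ * A * k * C / Real.sqrt q + 2 * A ^ 2 * k ^ 2 * C ^ 2 / q ^ 2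
      ≤ k ^ 2 + F * c₀ * k + 2 * c₀ ^ 2 * k ^ 2 := by
  have h1 : k ^ 2 / q ≤ k ^ 2 := div_le_self (by positivity) hq
  have hsq : 1 ≤ Real.sqrt q := Real.one_le_sqrt.mpr hq
  have h2 : -(φ * A * k * C / Real.sqrt q) ≤ F * c₀ * k := by
    calc -(φ * A * k * C / Real.sqrt q) = (φ * A * k * -C) / Real.sqrt q := by ring
      _ ≤ (φ * A * k * 1) / Real.sqrt q := by
        gcongr
        linarith [(abs_le.mp hC).1]
      _ ≤ φ * A * k * 1 := div_le_self (by positivity) hsq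
      _ ≤ F * c₀ * k := by
        rw [mul_one]
        gcongr
        exact hφ.trans hφF
  have h3 : 2 * A ^ 2 * k ^ 2 * C ^ 2 / q ^ 2 ≤ 2 * c₀ ^ 2 * k ^ 2 := by
    calc 2 * A ^ 2 * k ^ 2 * C ^ 2 / q ^ 2 ≤ 2 * A ^ 2 * k ^ 2 * C ^ 2 :=
          div_le_self (by positivity) (one_le_pow₀ hq)
      _ ≤ 2 * c₀ ^ 2 * k ^ 2 * 1 := by
        gcongr
        exact (sq_le_one_iff_abs_le_one C).mpr hC
      _ = 2 * c₀ ^ 2 * k ^ 2 := mul_one _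
  linarith

/-- Lemma 4.3: if `f` is continuous, `ℤ`-periodic and positive, `c₀ > 0`
and `a < b` in `[0,1/2]`, then there is `M > 0` such that
`w(x,t) = c₀ e^{−Mt} sin(π(x−a)/(b−a))` satisfies, for all `x ∈ [a,b]`, `t ≥ 0` and all
`p ∈ ℝ` (playing the role of `u_x(x,t)`),
`w_t ≤ w_xx/(p²+1) + f(x) w w_x/√(p²+1) − 2w (w_x)²/(p²+1)²`, and `w(a,t) = w(b,t) = 0`;
that is, `w` is a subsolution of the differentiated equation regardless of the solution. -/
theorem explicit_subsolution (f : ℝ → ℝ) (hfc : Continuous f)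
    (hfper : ∀ x, f (x + 1) = f x) (hfpos : ∀ x, 0 < f x)
    (c₀ : ℝ) (hc₀ : 0 < c₀)
    (a b : ℝ) (ha : a ∈ Set.Icc (0 : ℝ) (1 / 2)) (hb : b ∈ Set.Icc (0 : ℝ) (1 / 2))
    (hab : a < b) :
    ∃ M : ℝ, 0 < M ∧ ∀ w : ℝ → ℝ → ℝ,
      (∀ x t : ℝ, w x t = c₀ * Real.exp (-M * t) * Real.sin (π * (x - a) / (b - a))) →
      (∀ x ∈ Set.Icc a b, ∀ t : ℝ, 0 ≤ t → ∀ p : ℝ,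
        pdt w x t ≤ pdxx w x t / (p ^ 2 + 1)
          + f x * w x t * pdx w x t / Real.sqrt (p ^ 2 + 1)
          - 2 * w x t * (pdx w x t) ^ 2 / (p ^ 2 + 1) ^ 2) ∧
      (∀ t : ℝ, 0 ≤ t → w a t = 0 ∧ w b t = 0) := by
  obtain ⟨z, hz, hmax⟩ := isCompact_Icc.exists_isMaxOn (nonempty_Icc.mpr hab.le) hfc.continuousOn
  have hd : 0 < b - a := sub_pos.mpr hab
  have hk : 0 < π / (b - a) := div_pos Real.pi_pos hd
  have hF := hfpos z
  set k := π / (b - a)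
  obtain ⟨M, hM⟩ : ∃ M, M = k ^ 2 + f z * c₀ * k + 2 * c₀ ^ 2 * k ^ 2 := ⟨_, rfl⟩
  have hMpos : 0 < M := by rw [hM]; positivity
  refine ⟨M, hMpos, fun w hw => ⟨fun x hx t ht p => ?_, fun t _ => ⟨?_, ?_⟩⟩⟩
  · have hwx : ∀ y, pdx w y t
        = c₀ * Real.exp (-M * t) * k * Real.cos (π * (y - a) / (b - a)) := fun y => by
      simp only [pdx, hw]
      exact (hasDerivAt_sin_affine _ a (b - a) y).deriv
    have hwxx : pdxx w x t
        = -(c₀ * Real.exp (-M * t) * k * k * Real.sin (π * (x - a) / (b - a))) := by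
      simp only [pdxx, hwx]
      exact (hasDerivAt_cos_affine _ a (b - a) x).deriv
    have hwt : pdt w x t
        = -M * (c₀ * Real.exp (-M * t) * Real.sin (π * (x - a) / (b - a))) := by
      simp only [pdt, hw]
      have h : HasDerivAt (fun s : ℝ => -M * s) (-M) t := by
        simpa using (hasDerivAt_id t).const_mul (-M)
      rw [((h.exp.const_mul c₀).mul_const _).deriv]
      ring
    have hS : 0 ≤ Real.sin (π * (x - a) / (b - a)) := by
      apply Real.sin_nonneg_of_nonneg_of_le_pi
      · exact div_nonneg (mul_nonneg Real.pi_pos.le (sub_nonneg.mpr hx.1)) hd.le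
      · rw [div_le_iff₀ hd]
        gcongr
        exact hx.2
    have hA : 0 ≤ c₀ * Real.exp (-M * t) := by positivity
    have hAc : c₀ * Real.exp (-M * t) ≤ c₀ := by
      apply mul_le_of_le_one_right hc₀.le
      rw [Real.exp_le_one_iff]
      nlinarith
    have hq : 1 ≤ p ^ 2 + 1 := by linarith [sq_nonneg p]
    have key := mul_le_mul_of_nonneg_left
      (rate_bound hk.le hA hAc (Real.abs_cos_le_one (π * (x - a) / (b - a)))
        (hfpos x).le (hmax hx) hq) (mul_nonneg hA hS)
    rw [← hM] at key
    rw [hwt, hwxx, hwx, hw]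
    generalize c₀ * Real.exp (-M * t) = A at *
    refine le_of_eq_of_le (by ring) ((neg_le_neg key).trans (le_of_eq ?_))
    ring
  · simp [hw]
  · rw [hw, mul_div_assoc, div_self hd.ne', mul_one, Real.sin_pi, mul_zero]
end
end

section
/- Assume (A1) and additionally that f is C². Let δ ∈ (0, min_{ℝ} f) be such that (f(x) − δ) g(x) > n − 1 for all x ∈ ℝ, and define ψ(x) := (n−1)/(f(x) − δ). Then ψ(x) < g(x) for all x ∈ ℝ, and there exists ε₀ > 0 such that for all ε ∈ (0, ε₀) and all x ∈ ℝ: −ε² ψ''(x)/(1 + ε² ψ'(x)²) ≤ f(x) √(ε² ψ'(x)² + 1) − (n−1)/ψ(x); moreover the right-hand side satisfies f(x) √(ε² ψ'(x)² + 1) − (n−1)/ψ(x) ≥ δ for all x. (Thus ψ is a time-independent subsolution of the equation satisfied by v^ε = u^ε/ε.) -/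
open Real Set Filter Topology

noncomputable section

/-- A continuous periodic function on `ℝ` is bounded in absolute value by a positive constant. -/
theorem exists_pos_abs_le_of_periodic {h : ℝ → ℝ} (hp : Function.Periodic h 1)
    (hc : Continuous h) : ∃ M : ℝ, 0 < M ∧ ∀ x, |h x| ≤ M := by
  obtain ⟨M, hM0, hM⟩ := (hp.isBounded_of_continuous one_ne_zero hc).exists_pos_norm_le
  exact ⟨M, hM0, fun x => hM _ ⟨x, rfl⟩⟩

/-- The derivative of a periodic function is periodic. -/
theorem periodic_deriv {h : ℝ → ℝ} {c : ℝ} (hp : Function.Periodic h c) :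
    Function.Periodic (deriv h) c := fun x => by
  rw [← deriv_comp_add_const, hp.funext]

/-- under (A1) with `f` moreover `C²`, if `δ ∈ (0, min f)` satisfies
`(f(x) − δ) g(x) > n − 1` for all `x`, then `ψ(x) := (n−1)/(f(x) − δ)` satisfies
`ψ < g` everywhere, and there is `ε₀ > 0` such that for all `ε ∈ (0, ε₀)` and all `x`,
`−ε² ψ''/(1 + ε² (ψ')²) ≤ f(x)√(ε²(ψ')² + 1) − (n−1)/ψ`, and moreover the right-hand
side is `≥ δ` everywhere; thus `ψ` is a time-independent subsolution of the equation
satisfied by `v^ε = u^ε/ε`. -/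
theorem psi_subsolution (n : ℕ) (hn : 2 ≤ n) (f g : ℝ → ℝ) (hA1 : A1 f g)
    (hf2 : ContDiff ℝ 2 f)
    (δ : ℝ) (hδ0 : 0 < δ) (hδf : δ < sInf (Set.range f))
    (hfg : ∀ x : ℝ, (n : ℝ) - 1 < (f x - δ) * g x) :
    ∀ ψ : ℝ → ℝ, (∀ x : ℝ, ψ x = ((n : ℝ) - 1) / (f x - δ)) →
      (∀ x : ℝ, ψ x < g x) ∧
      ∃ ε₀ : ℝ, 0 < ε₀ ∧ ∀ ε : ℝ, 0 < ε → ε < ε₀ → ∀ x : ℝ,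
        (-(ε ^ 2 * deriv (deriv ψ) x) / (1 + ε ^ 2 * (deriv ψ x) ^ 2)
          ≤ f x * Real.sqrt (ε ^ 2 * (deriv ψ x) ^ 2 + 1) - ((n : ℝ) - 1) / ψ x) ∧
        (δ ≤ f x * Real.sqrt (ε ^ 2 * (deriv ψ x) ^ 2 + 1) - ((n : ℝ) - 1) / ψ x) := by
  intro ψ hψ
  obtain ⟨-, hper, hpos, -⟩ := hA1
  have hn' : (0 : ℝ) < (n : ℝ) - 1 := by
    have : (2 : ℝ) ≤ n := by exact_mod_cast hn
    linarith
  have hbdd : BddBelow (Set.range f) := ⟨0, by rintro _ ⟨x, rfl⟩; exact (hpos x).le⟩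
  have hfδ : ∀ x, 0 < f x - δ := fun x =>
    sub_pos.2 (hδf.trans_le (csInf_le hbdd ⟨x, rfl⟩))
  have hψC : ContDiff ℝ 2 ψ := by
    rw [funext hψ]
    exact contDiff_const.div (hf2.sub contDiff_const) fun x => (hfδ x).ne'
  have hψper : Function.Periodic ψ 1 := fun x => by rw [hψ, hψ, hper]
  have hcont : Continuous (deriv (deriv ψ)) := by
    have h1 : ContDiff ℝ 1 (deriv ψ) := hψC.iterate_deriv' 1 1
    exact h1.continuous_deriv le_rfl
  obtain ⟨M, hM0, hM⟩ :=
    exists_pos_abs_le_of_periodic (periodic_deriv (periodic_deriv hψper)) hcont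
  have hlower : ∀ ε x : ℝ,
      δ ≤ f x * Real.sqrt (ε ^ 2 * (deriv ψ x) ^ 2 + 1) - ((n : ℝ) - 1) / ψ x := by
    intro ε x
    have hs : 1 ≤ Real.sqrt (ε ^ 2 * (deriv ψ x) ^ 2 + 1) :=
      Real.one_le_sqrt.2 (le_add_of_nonneg_left (by positivity))
    rw [hψ x, div_div_cancel₀ hn'.ne']
    linarith [le_mul_of_one_le_right (hpos x).le hs]
  refine ⟨fun x => ?_, Real.sqrt (δ / M), by positivity, fun ε hε hεlt x =>
    ⟨le_trans ?_ (hlower ε x), hlower ε x⟩⟩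
  · rw [hψ, div_lt_iff₀' (hfδ x)]
    exact hfg x
  · have hεM : ε ^ 2 * M ≤ δ := ((lt_div_iff₀ hM0).1 ((Real.lt_sqrt hε.le).1 hεlt)).le
    have hD : 0 ≤ ε ^ 2 * (deriv ψ x) ^ 2 := by positivity
    rw [div_le_iff₀ (by positivity)]
    calc -(ε ^ 2 * deriv (deriv ψ) x) = ε ^ 2 * -deriv (deriv ψ) x := by ring
      _ ≤ ε ^ 2 * M := by gcongr; exact (neg_le_abs _).trans (hM x)
      _ ≤ δ := hεM
      _ ≤ δ * (1 + ε ^ 2 * (deriv ψ x) ^ 2) :=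
        le_mul_of_one_le_right hδ0.le (le_add_of_nonneg_right hD)
end
end

section
/- Assume (A1), take α = 1 and ε > 0, and let u be a positive classical solution of the scaled problem on ℝ × [0,T). Set C₁ := ε² max_{ℝ}|g''| + (max_{ℝ} f)·√(ε² max_{ℝ}(g')² + 1) + 2(n−1)/min_{ℝ} g and σ₁ := ε² (min_{ℝ} g)/(2C₁). Then |u(x,t) − ε g(x)| ≤ C₁ t/ε for all x ∈ ℝ and all t ∈ [0, min(σ₁, T)). -/
open Real Set Filter Topology

noncomputable section

/-- The constant `C₁ = ε² max|g''| + (max f)·√(ε² max (g')² + 1) + 2(n−1)/min g`. -/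
def C1 (n : ℕ) (f g : ℝ → ℝ) (ε : ℝ) : ℝ :=
  ε ^ 2 * sSup (Set.range fun x => |deriv (deriv g) x|) +
    sSup (Set.range f) * Real.sqrt (ε ^ 2 * sSup (Set.range fun x => (deriv g x) ^ 2) + 1) +
    2 * ((n : ℝ) - 1) / sInf (Set.range g)

/-- A continuous periodic function has compact range. -/
theorem isCompact_range_of_periodic {h : ℝ → ℝ} (hc : Continuous h) (hp : ∀ x, h (x + 1) = h x) :
    IsCompact (Set.range h) :=
  Function.Periodic.compact_of_continuous (c := 1) hp one_ne_zero hc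

theorem deriv_periodic {h : ℝ → ℝ} (hp : ∀ x, h (x + 1) = h x) (x : ℝ) :
    deriv h (x + 1) = deriv h x := by
  rw [← deriv_comp_add_const, funext hp]

/-- Second-order necessary condition at a local maximum. -/
theorem deriv_deriv_nonpos_of_isLocalMax {h : ℝ → ℝ} {x : ℝ} (hc : ContinuousAt h x)
    (hx : IsLocalMax h x) : deriv (deriv h) x ≤ 0 := by
  by_contra! hpos
  have hmin := isLocalMin_of_deriv_deriv_pos hpos hx.deriv_eq_zero hc
  have hconst : h =ᶠ[𝓝 x] fun _ => h x := by
    filter_upwards [hx, hmin] with y h₁ h₂ using le_antisymm h₁ h₂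
  have : deriv (deriv h) x = 0 := by
    rw [hconst.deriv.deriv_eq]
    simp
  linarith

/-- A function whose value at `t` dominates its values on `[0, t]` has nonnegative derivative
at `t > 0`. -/
theorem deriv_nonneg_of_le_left {h : ℝ → ℝ} {t d : ℝ} (ht : 0 < t) (hd : HasDerivAt h d t)
    (hle : ∀ s, 0 ≤ s → s ≤ t → h s ≤ h t) : 0 ≤ d := by
  have hs := (hasDerivWithinAt_iff_tendsto_slope' (s := Iio t) (by simp)).1
    hd.hasDerivWithinAt
  refine ge_of_tendsto hs ?_
  filter_upwards [Ioo_mem_nhdsLT ht] with s hs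
  rw [slope_def_field]
  exact div_nonneg_of_nonpos (by linarith [hle s hs.1.le hs.2.le]) (by linarith [hs.2])

/-- First time at which a function, periodic in space, reaches the level `η`. -/
theorem exists_first_touching {φ : ℝ → ℝ → ℝ} {t₁ η x₁ : ℝ}
    (hc : ContinuousOn (fun p : ℝ × ℝ => φ p.1 p.2) {p | 0 ≤ p.2 ∧ p.2 ≤ t₁})
    (hp : ∀ x t, φ (x + 1) t = φ x t) (h0 : ∀ x, φ x 0 < η) (ht₁ : 0 ≤ t₁)
    (h₁ : η ≤ φ x₁ t₁) :
    ∃ x₀ t₀, 0 < t₀ ∧ t₀ ≤ t₁ ∧ φ x₀ t₀ = η ∧ (∀ x, φ x t₀ ≤ η) ∧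
      ∀ s, 0 ≤ s → s ≤ t₀ → φ x₀ s ≤ η := by
  have hper : ∀ t, Function.Periodic (fun x => φ x t) 1 := fun t x => hp x t
  let K : Set (ℝ × ℝ) := Icc 0 1 ×ˢ Icc 0 t₁
  have hK : IsCompact K := isCompact_Icc.prod isCompact_Icc
  have hcK : ContinuousOn (fun p : ℝ × ℝ => φ p.1 p.2) K := hc.mono fun p hp => hp.2
  have hS : IsCompact (K ∩ (fun p : ℝ × ℝ => φ p.1 p.2) ⁻¹' Ici η) :=
    hK.of_isClosed_subset (hcK.preimage_isClosed_of_isClosed hK.isClosed isClosed_Ici)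
      inter_subset_left
  have hne : (K ∩ (fun p : ℝ × ℝ => φ p.1 p.2) ⁻¹' Ici η).Nonempty := by
    obtain ⟨y, hy, hxy⟩ := (hper t₁).exists_mem_Ico₀ one_pos x₁
    exact ⟨(y, t₁), ⟨⟨hy.1, hy.2.le⟩, ht₁, le_rfl⟩, h₁.trans_eq hxy⟩
  obtain ⟨⟨x₀, t₀⟩, ⟨⟨hx₀, ht₀⟩, hη⟩, hmin⟩ := hS.exists_isMinOn hne continuous_snd.continuousOn
  simp only [mem_Icc, mem_preimage, mem_Ici] at hx₀ ht₀ hη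
  have hbefore : ∀ x s, 0 ≤ s → s < t₀ → φ x s < η := by
    intro x s hs hst
    by_contra! hle
    obtain ⟨y, hy, hxy⟩ := (hper s).exists_mem_Ico₀ one_pos x
    have := isMinOn_iff.1 hmin (y, s)
      ⟨⟨⟨hy.1, hy.2.le⟩, hs, hst.le.trans ht₀.2⟩, hle.trans_eq hxy⟩
    exact absurd this (not_le.2 hst)
  have hpos : 0 < t₀ := by
    refine ht₀.1.lt_of_ne fun h => ?_
    subst h
    exact absurd hη (not_le.2 (h0 x₀))
  have hat : ∀ x, φ x t₀ ≤ η := by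
    intro x
    have hcx : ContinuousOn (fun s => φ x s) (Icc 0 t₀) :=
      hc.comp (f := fun s : ℝ => (x, s)) (by fun_prop) fun s hs => ⟨hs.1, hs.2.trans ht₀.2⟩
    have htend : Tendsto (fun s => φ x s) (𝓝[<] t₀) (𝓝 (φ x t₀)) :=
      (hcx t₀ ⟨hpos.le, le_rfl⟩).mono_left
        (nhdsWithin_le_of_mem (mem_of_superset (Ioo_mem_nhdsLT hpos) Ioo_subset_Icc_self))
    refine le_of_tendsto htend ?_
    filter_upwards [Ioo_mem_nhdsLT hpos] with s hs using (hbefore x s hs.1.le hs.2).le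
  refine ⟨x₀, t₀, hpos, ht₀.2, le_antisymm (hat x₀) hη, hat, fun s hs hst => ?_⟩
  rcases hst.lt_or_eq with h | rfl
  · exact (hbefore x₀ s hs h).le
  · exact hat x₀

theorem IsSol.contDiff_space {n : ℕ} {f g : ℝ → ℝ} {ε α : ℝ} {T : EReal} {u : ℝ → ℝ → ℝ}
    (hu : IsSol n f g ε α T u) {t : ℝ} (ht : 0 < t) (htT : (t : EReal) < T) :
    ContDiff ℝ 2 fun x => u x t := by
  rw [← contDiffOn_univ]
  exact (contDiffOn_infty.1 hu.smooth 2).comp (f := fun x : ℝ => (x, t)) (by fun_prop) fun _ _ => ⟨ht, htT⟩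

theorem IsSol.hasDerivAt_time {n : ℕ} {f g : ℝ → ℝ} {ε α : ℝ} {T : EReal} {u : ℝ → ℝ → ℝ}
    (hu : IsSol n f g ε α T u) (x : ℝ) {t : ℝ} (ht : 0 < t) (htT : (t : EReal) < T) :
    HasDerivAt (fun s => u x s) (pdt u x t) t := by
  have hopen : IsOpen {p : ℝ × ℝ | 0 < p.2 ∧ (p.2 : EReal) < T} :=
    (isOpen_lt continuous_const continuous_snd).inter
      (isOpen_lt (continuous_coe_real_ereal.comp continuous_snd) continuous_const)
  have hd : DifferentiableAt ℝ (fun p : ℝ × ℝ => u p.1 p.2) (x, t) :=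
    (hu.smooth.contDiffAt (hopen.mem_nhds ⟨ht, htT⟩)).differentiableAt (by simp)
  have := hd.comp t (f := fun s : ℝ => (x, s)) (by fun_prop)
  exact DifferentiableAt.hasDerivAt this

theorem deriv_deriv_sub {h k : ℝ → ℝ} (hh : ContDiff ℝ 2 h) (hk : ContDiff ℝ 2 k) (x : ℝ) :
    deriv (deriv fun y => h y - k y) x = deriv (deriv h) x - deriv (deriv k) x := by
  have hd : (deriv fun y => h y - k y) = fun y => deriv h y - deriv k y := by
    funext y
    exact deriv_fun_sub (hh.differentiable two_ne_zero y) (hk.differentiable two_ne_zero y)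
  have h2 : ∀ {k : ℝ → ℝ}, ContDiff ℝ 2 k → Differentiable ℝ (deriv k) := fun hk =>
    (contDiff_succ_iff_deriv (n := 1)).1 hk |>.2.2.differentiable one_ne_zero
  rw [hd, deriv_fun_sub (h2 hh x) (h2 hk x)]

/-- Where `h - k` has a maximum, first derivatives agree and second derivatives are ordered. -/
theorem deriv_eq_and_deriv_deriv_le {h k : ℝ → ℝ} (hh : ContDiff ℝ 2 h) (hk : ContDiff ℝ 2 k)
    {x : ℝ} (hx : ∀ y, h y - k y ≤ h x - k x) :
    deriv h x = deriv k x ∧ deriv (deriv h) x ≤ deriv (deriv k) x := by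
  have hmax : IsLocalMax (fun y => h y - k y) x := Eventually.of_forall hx
  have h1 := hmax.deriv_eq_zero
  rw [deriv_fun_sub (hh.differentiable two_ne_zero x) (hk.differentiable two_ne_zero x)] at h1
  have h2 := deriv_deriv_nonpos_of_isLocalMax (h := fun y => h y - k y)
    (hh.continuous.sub hk.continuous).continuousAt hmax
  rw [deriv_deriv_sub hh hk] at h2
  exact ⟨by linarith, by linarith⟩

section Barrier

variable {n : ℕ} {f g : ℝ → ℝ} {ε : ℝ}

theorem A1.sInf_range_pos (hA : A1 f g) : 0 < sInf (Set.range g) := by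
  obtain ⟨x, hx⟩ := (isCompact_range_of_periodic hA.2.2.2.1.continuous hA.2.2.2.2.1).sInf_mem
    (Set.range_nonempty g)
  exact hx ▸ hA.2.2.2.2.2 x

theorem A1.sInf_range_le (hA : A1 f g) (x : ℝ) : sInf (Set.range g) ≤ g x :=
  csInf_le (isCompact_range_of_periodic hA.2.2.2.1.continuous hA.2.2.2.2.1).bddBelow ⟨x, rfl⟩

theorem A1.le_sSup_range (hA : A1 f g) (x : ℝ) : f x ≤ sSup (Set.range f) :=
  le_csSup (isCompact_range_of_periodic hA.1.continuous hA.2.1).bddAbove ⟨x, rfl⟩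

theorem A1.sq_deriv_le (hA : A1 f g) (x : ℝ) :
    deriv g x ^ 2 ≤ sSup (Set.range fun x => (deriv g x) ^ 2) :=
  le_csSup (isCompact_range_of_periodic (h := fun x => deriv g x ^ 2)
    ((hA.2.2.2.1.continuous_deriv one_le_two).pow 2) fun x => by rw [deriv_periodic hA.2.2.2.2.1]).bddAbove ⟨x, rfl⟩

theorem A1.abs_deriv_deriv_le (hA : A1 f g) (x : ℝ) :
    |deriv (deriv g) x| ≤ sSup (Set.range fun x => |deriv (deriv g) x|) := by
  have hc : Continuous (deriv (deriv g)) :=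
    (contDiff_succ_iff_deriv (n := 1)).1 hA.2.2.2.1 |>.2.2.continuous_deriv le_rfl
  exact le_csSup (isCompact_range_of_periodic hc.abs
    fun x => by rw [deriv_periodic (deriv_periodic hA.2.2.2.2.1)]).bddAbove ⟨x, rfl⟩

/-- The value of the diffusion and forcing terms on the profile `ε g`, together with the
curvature term bounded by `2 (n - 1) / (ε min g)`, is controlled by `C1 / ε`. -/
theorem A1.forcing_le (hA : A1 f g) (hε : 0 < ε) (x : ℝ) :
    ε * |deriv (deriv g) x| + 1 / ε * f x * √((ε * deriv g x) ^ 2 + 1)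
      + 2 * ((n : ℝ) - 1) / (ε * sInf (Set.range g)) ≤ C1 n f g ε / ε := by
  have hm := hA.sInf_range_pos
  have hG := hA.abs_deriv_deriv_le x
  have hsq : √((ε * deriv g x) ^ 2 + 1)
      ≤ √(ε ^ 2 * sSup (Set.range fun x => (deriv g x) ^ 2) + 1) := by
    rw [mul_pow]
    gcongr
    exact hA.sq_deriv_le x
  have hF := mul_le_mul (hA.le_sSup_range x) hsq (sqrt_nonneg _)
    ((hA.2.2.1 x).le.trans (hA.le_sSup_range x))
  rw [le_div_iff₀ hε, C1]
  have e : (ε * |deriv (deriv g) x| + 1 / ε * f x * √((ε * deriv g x) ^ 2 + 1)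
      + 2 * ((n : ℝ) - 1) / (ε * sInf (Set.range g))) * ε
      = ε ^ 2 * |deriv (deriv g) x| + f x * √((ε * deriv g x) ^ 2 + 1)
      + 2 * ((n : ℝ) - 1) / sInf (Set.range g) := by
    field_simp
  rw [e]
  gcongr

theorem abs_div_sq_add_one_le (a b : ℝ) : |a / (b ^ 2 + 1)| ≤ |a| := by
  rw [abs_div, abs_of_pos (by positivity : 0 < b ^ 2 + 1)]
  exact div_le_self (abs_nonneg a) (by nlinarith [sq_nonneg b])

variable {T : EReal} {u : ℝ → ℝ → ℝ}

theorem IsSol.continuousOn_sub (hu : IsSol n f g ε 1 T u) (hA : A1 f g) {t₁ : ℝ}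
    (ht₁ : (t₁ : EReal) < T) :
    ContinuousOn (fun p : ℝ × ℝ => u p.1 p.2 - ε * g p.1) {p | 0 ≤ p.2 ∧ p.2 ≤ t₁} := by
  have hg := hA.2.2.2.1.continuous
  exact (hu.cont.mono fun p hp => ⟨hp.1, (EReal.coe_le_coe_iff.2 hp.2).trans_lt ht₁⟩).sub
    (by fun_prop)

theorem IsSol.upper_barrier (hn : 2 ≤ n) (hA : A1 f g) (hε : 0 < ε)
    (hu : IsSol n f g ε 1 T u) (x t : ℝ) (ht : 0 ≤ t) (htT : (t : EReal) < T) :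
    u x t - ε * g x ≤ C1 n f g ε * t / ε := by
  by_contra! hlt
  obtain ⟨x₀, t₀, hpos, hle, heq, hspace, htime⟩ := exists_first_touching
    (φ := fun x t => u x t - ε * g x - C1 n f g ε * t / ε)
    (η := u x t - ε * g x - C1 n f g ε * t / ε)
    ((hu.continuousOn_sub hA htT).sub (by fun_prop))
    (fun x t => by rw [hu.periodic, hA.2.2.2.2.1])
    (fun y => by simp only [hu.init, rpow_one, mul_zero, zero_div]; linarith) ht le_rfl
  have htT₀ : (t₀ : EReal) < T := (EReal.coe_le_coe_iff.2 hle).trans_lt htT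
  have hεg : ContDiff ℝ 2 fun y => ε * g y := contDiff_const.mul hA.2.2.2.1
  obtain ⟨hx, hxx⟩ := deriv_eq_and_deriv_deriv_le
    (hu.contDiff_space hpos htT₀) hεg (x := x₀)
    fun y => by linarith [hspace y]
  simp only [deriv_const_mul_field, deriv_const_mul_field'] at hx hxx
  change pdx u x₀ t₀ = _ at hx
  change pdxx u x₀ t₀ ≤ _ at hxx
  have hdt := deriv_nonneg_of_le_left hpos
    (((hu.hasDerivAt_time x₀ hpos htT₀).sub_const (ε * g x₀)).sub
      (((hasDerivAt_id t₀).const_mul (C1 n f g ε)).div_const ε))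
    fun s hs hst => (htime s hs hst).trans_eq heq.symm
  have heqn := hu.eqn x₀ t₀ hpos htT₀
  have hforce := hA.forcing_le (n := n) hε x₀
  have hn' : (0 : ℝ) < n - 1 := by
    have : (2 : ℝ) ≤ n := by exact_mod_cast hn
    linarith
  have hcurv : 0 < ((n : ℝ) - 1) / u x₀ t₀ := div_pos hn' (hu.pos x₀ t₀ hpos.le htT₀)
  have hm := hA.sInf_range_pos
  have hslack : 0 < 2 * ((n : ℝ) - 1) / (ε * sInf (Set.range g)) := by positivity
  have hdiff : pdxx u x₀ t₀ / (pdx u x₀ t₀ ^ 2 + 1) ≤ ε * |deriv (deriv g) x₀| := by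
    calc _ ≤ ε * deriv (deriv g) x₀ / (pdx u x₀ t₀ ^ 2 + 1) := by gcongr
      _ ≤ |ε * deriv (deriv g) x₀| := (le_abs_self _).trans (abs_div_sq_add_one_le _ _)
      _ = _ := by rw [abs_mul, abs_of_pos hε]
  rw [← hx] at hforce
  simp only [mul_one] at hdt
  linarith

theorem A1.C1_pos (hn : 2 ≤ n) (hA : A1 f g) (hε : 0 < ε) : 0 < C1 n f g ε := by
  have hn' : (0 : ℝ) < n - 1 := by
    have : (2 : ℝ) ≤ n := by exact_mod_cast hn
    linarith
  have hm := hA.sInf_range_pos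
  have hf := hA.2.2.1 0
  have h : 0 < C1 n f g ε / ε := lt_of_lt_of_le (by positivity) (hA.forcing_le hε 0)
  exact (div_pos_iff_of_pos_right hε).1 h

theorem IsSol.lower_barrier (hn : 2 ≤ n) (hA : A1 f g) (hε : 0 < ε)
    (hu : IsSol n f g ε 1 T u) (x t : ℝ) (ht : 0 ≤ t)
    (hσ : t < ε ^ 2 * sInf (Set.range g) / (2 * C1 n f g ε)) (htT : (t : EReal) < T) :
    -(C1 n f g ε * t / ε) ≤ u x t - ε * g x := by
  by_contra! hlt
  have hC := hA.C1_pos hn hε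
  have hm := hA.sInf_range_pos
  have hσ' : C1 n f g ε * t / ε < ε * sInf (Set.range g) / 2 := by
    rw [lt_div_iff₀ (by positivity)] at hσ
    rw [div_lt_iff₀ hε]
    linarith
  obtain ⟨η, hη, hη_min⟩ := exists_between (lt_min
    (by linarith : 0 < -(C1 n f g ε * t / ε) - (u x t - ε * g x))
    (by linarith : 0 < ε * sInf (Set.range g) / 2 - C1 n f g ε * t / ε))
  obtain ⟨hη₁, hη₂⟩ := lt_min_iff.1 hη_min
  obtain ⟨x₀, t₀, hpos, hle, heq, hspace, htime⟩ := exists_first_touching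
    (φ := fun x t => -(u x t - ε * g x) - C1 n f g ε * t / ε) (η := η) (x₁ := x)
    ((hu.continuousOn_sub hA htT).neg.sub (by fun_prop))
    (fun x t => by rw [hu.periodic, hA.2.2.2.2.1])
    (fun y => by simp only [hu.init, rpow_one, mul_zero, zero_div]; linarith) ht (by linarith)
  have htT₀ : (t₀ : EReal) < T := (EReal.coe_le_coe_iff.2 hle).trans_lt htT
  have hεg : ContDiff ℝ 2 fun y => ε * g y := contDiff_const.mul hA.2.2.2.1
  obtain ⟨hx, hxx⟩ := deriv_eq_and_deriv_deriv_le hεg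
    (hu.contDiff_space hpos htT₀) (x := x₀)
    fun y => by linarith [hspace y]
  simp only [deriv_const_mul_field, deriv_const_mul_field'] at hx hxx
  change _ = pdx u x₀ t₀ at hx
  change _ ≤ pdxx u x₀ t₀ at hxx
  have hdt := deriv_nonneg_of_le_left hpos
    (((hu.hasDerivAt_time x₀ hpos htT₀).sub_const (ε * g x₀)).neg.sub
      (((hasDerivAt_id t₀).const_mul (C1 n f g ε)).div_const ε))
    fun s hs hst => (htime s hs hst).trans_eq heq.symm
  have heqn := hu.eqn x₀ t₀ hpos htT₀
  have hforce := hA.forcing_le (n := n) hε x₀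
  have hn' : (0 : ℝ) < n - 1 := by
    have : (2 : ℝ) ≤ n := by exact_mod_cast hn
    linarith
  have hhalf : ε * sInf (Set.range g) / 2 ≤ u x₀ t₀ := by
    have h₁ : C1 n f g ε * t₀ / ε ≤ C1 n f g ε * t / ε := by gcongr
    have h₂ : ε * sInf (Set.range g) ≤ ε * g x₀ := by gcongr; exact hA.sInf_range_le x₀
    linarith
  have hcurv : ((n : ℝ) - 1) / u x₀ t₀ ≤ 2 * ((n : ℝ) - 1) / (ε * sInf (Set.range g)) := by
    calc _ ≤ ((n : ℝ) - 1) / (ε * sInf (Set.range g) / 2) := by gcongr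
      _ = _ := by field_simp
  have hdiff : -(ε * |deriv (deriv g) x₀|) ≤ pdxx u x₀ t₀ / (pdx u x₀ t₀ ^ 2 + 1) := by
    calc _ = -|ε * deriv (deriv g) x₀| := by rw [abs_mul, abs_of_pos hε]
      _ ≤ ε * deriv (deriv g) x₀ / (pdx u x₀ t₀ ^ 2 + 1) :=
        neg_le_of_neg_le ((neg_le_abs _).trans (abs_div_sq_add_one_le _ _))
      _ ≤ _ := by gcongr
  have hf := hA.2.2.1 x₀
  have hsource : 0 < 1 / ε * f x₀ * √(pdx u x₀ t₀ ^ 2 + 1) := by positivity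
  rw [hx] at hforce
  simp only [mul_one] at hdt
  linarith

end Barrier

/-- under (A1), `α = 1`, `ε > 0`, any positive classical solution `u` of
the scaled problem on `ℝ × [0,T)` satisfies `|u(x,t) − ε g(x)| ≤ C₁ t/ε` for all `x` and
all `t ∈ [0, min(σ₁, T))`, where `σ₁ = ε² (min g)/(2C₁)`. -/
theorem initial_layer_estimate (n : ℕ) (hn : 2 ≤ n) (f g : ℝ → ℝ) (hA1 : A1 f g)
    (ε : ℝ) (hε : 0 < ε) (T : EReal) (hT : 0 < T) (u : ℝ → ℝ → ℝ)
    (hu : IsSol n f g ε 1 T u) :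
    ∀ x t : ℝ, 0 ≤ t →
      t < ε ^ 2 * sInf (Set.range g) / (2 * C1 n f g ε) → (t : EReal) < T →
      |u x t - ε * g x| ≤ C1 n f g ε * t / ε := by
  intro x t ht hσ htT
  exact abs_le.2 ⟨hu.lower_barrier hn hA1 hε x t ht hσ htT, hu.upper_barrier hn hA1 hε x t ht htT⟩
end
end
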